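/- arXiv:1104.0450 — 3 statements merged into one kernel-verified Lean document; each statement's English description precedes it below -/
import Mathlib

section
/- (Li–Jia conjecture for n = 2.) Let f be a smooth, strictly convex function defined for all (x₁,x₂) ∈ ℝ². If f satisfies the Abreu equation ∑_{i,j=1}^{2} F^{ij} ∂²w/∂x_i∂x_j = 0 with w := [det(∂²f/∂x_i∂x_j)]^{−1} on all of ℝ², then f is a quadratic polynomial. -/
open Real Filter Topology Matrix

noncomputable section

/-- The `i`-th partial derivative of `f`. -/
def pd {n : ℕ} (i : Fin n) (f : (Fin n → ℝ) → ℝ) : (Fin n → ℝ) → ℝ :=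
  fun x => fderiv ℝ f x (Pi.single i 1)

/-- The Hessian matrix `(∂²f/∂x_i∂x_j)` of `f` at `x`. -/
def hess {n : ℕ} (f : (Fin n → ℝ) → ℝ) (x : Fin n → ℝ) : Matrix (Fin n) (Fin n) ℝ :=
  Matrix.of fun i j => pd i (pd j f) x

/-- The gradient vector of `f` at `x`. -/
def gradv {n : ℕ} (f : (Fin n → ℝ) → ℝ) (x : Fin n → ℝ) : Fin n → ℝ :=
  fun i => pd i f x

/-- `ρ := (det (f_ij))^(-1/(n+2))`. -/
def rho {n : ℕ} (f : (Fin n → ℝ) → ℝ) (x : Fin n → ℝ) : ℝ :=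
  (hess f x).det ^ (-(1 : ℝ) / ((n : ℝ) + 2))

/-- The squared norm `‖grad h‖² = ∑ f^{ij} h_i h_j` with respect to the Calabi metric of `f`. -/
def gradSq {n : ℕ} (f h : (Fin n → ℝ) → ℝ) (x : Fin n → ℝ) : ℝ :=
  ∑ i, ∑ j, (hess f x)⁻¹ i j * pd i h x * pd j h x

/-- The Laplacian `Δh = (1/√det)(∑ ∂_i(√det · f^{ij} ∂_j h))` with respect to the
Calabi metric of `f`. -/
def calabiLap {n : ℕ} (f h : (Fin n → ℝ) → ℝ) (x : Fin n → ℝ) : ℝ :=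
  (Real.sqrt (hess f x).det)⁻¹ *
    ∑ i, ∑ j, pd i (fun y => Real.sqrt (hess f y).det * (hess f y)⁻¹ i j * pd j h y) x

/-- `Φ := ‖grad ρ‖²/ρ²`. -/
def Phi {n : ℕ} (f : (Fin n → ℝ) → ℝ) (x : Fin n → ℝ) : ℝ :=
  gradSq f (rho f) x / (rho f x) ^ 2

/-- PDE (1.2): `Δρ = -β ‖grad ρ‖²/ρ` on `Ω`. -/
def PDE2 {n : ℕ} (f : (Fin n → ℝ) → ℝ) (β : ℝ) (Ω : Set (Fin n → ℝ)) : Prop :=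
  ∀ x ∈ Ω, calabiLap f (rho f) x = -β * gradSq f (rho f) x / rho f x

/-- The cofactor matrix of a square matrix. -/
def cof {n : ℕ} (H : Matrix (Fin n) (Fin n) ℝ) : Matrix (Fin n) (Fin n) ℝ :=
  (Matrix.adjugate H)ᵀ

/-- PDE (1.1): `∑ F^{ij} w_ij = 0` with `w = (det (f_ij))^a` on `Ω`, where `(F^{ij})`
is the cofactor matrix of the Hessian of `f`. -/
def PDE1 {n : ℕ} (f : (Fin n → ℝ) → ℝ) (a : ℝ) (Ω : Set (Fin n → ℝ)) : Prop :=
  ∀ x ∈ Ω, ∑ i, ∑ j,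
    cof (hess f x) i j * pd i (pd j fun y => (hess f y).det ^ a) x = 0

/-- `f` is a quadratic polynomial on `ℝ²`. -/
def IsQuadratic (f : (Fin 2 → ℝ) → ℝ) : Prop :=
  ∃ (Q : Matrix (Fin 2) (Fin 2) ℝ) (b : Fin 2 → ℝ) (c : ℝ),
    ∀ x, f x = (∑ i, ∑ j, Q i j * x i * x j) + (∑ i, b i * x i) + c

/-- Euclidean open ball of radius `r` centered at `0` in `ℝ²`. -/
def ebal (r : ℝ) : Set (Fin 2 → ℝ) := {x | (x 0) ^ 2 + (x 1) ^ 2 < r ^ 2}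

/-- Euclidean norm on `ℝ²`. -/
def enorm2 (x : Fin 2 → ℝ) : ℝ := Real.sqrt ((x 0) ^ 2 + (x 1) ^ 2)

/-- A normalized convex domain: `B_{2^{-3/2}}(0) ⊆ Ω ⊆ B_1(0)`. -/
def NormalizedDomain (Ω : Set (Fin 2 → ℝ)) : Prop :=
  IsOpen Ω ∧ Convex ℝ Ω ∧ ebal ((2 : ℝ) ^ (-(3 : ℝ) / 2)) ⊆ Ω ∧ Ω ⊆ ebal 1

/-- The class `𝒮(Ω,C)`: smooth strictly convex functions on `Ω` with `inf f = 0` and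
`f = C` on `∂Ω`. -/
def SClass (Ω : Set (Fin 2 → ℝ)) (C : ℝ) (f : (Fin 2 → ℝ) → ℝ) : Prop :=
  ContDiffOn ℝ (⊤ : ℕ∞) f Ω ∧ (∀ x ∈ Ω, (hess f x).PosDef) ∧
    sInf (f '' Ω) = 0 ∧ ContinuousOn f (closure Ω) ∧ ∀ x ∈ frontier Ω, f x = C

/-- `u` is the Legendre transform function of `f` relative to `0`:
`u(∇f(x)) = ⟨x, ∇f(x)⟩ - f(x)`. -/
def LegendreOf (Ω : Set (Fin 2 → ℝ)) (f u : (Fin 2 → ℝ) → ℝ) : Prop :=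
  ∀ x ∈ Ω, u (gradv f x) = (∑ i, x i * gradv f x i) - f x

end

open MeasureTheory in
theorem aj_sm {f : (Fin 2 → ℝ) → ℝ} {n : ℕ∞} (hf : ContDiff ℝ ((n + 1 : ℕ∞) : WithTop ℕ∞) f) (i : Fin 2) :
    ContDiff ℝ (n : WithTop ℕ∞) (pd i f) := by
  unfold pd
  have h : ContDiff ℝ (n : WithTop ℕ∞) (fderiv ℝ f) := by
    apply hf.fderiv_right
    push_cast
    exact le_rfl
  exact h.clm_apply contDiff_const

theorem aj_smI {f : (Fin 2 → ℝ) → ℝ} (hf : ContDiff ℝ (⊤ : ℕ∞) f) (i : Fin 2) :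
    ContDiff ℝ (⊤ : ℕ∞) (pd i f) := by
  apply aj_sm
  simpa using hf

theorem aj_sm2 {f : (Fin 2 → ℝ) → ℝ} (hf : ContDiff ℝ 2 f) (i : Fin 2) :
    ContDiff ℝ 1 (pd i f) := by
  have := aj_sm (n := 1) (f := f) (by convert hf using 1; norm_num; try rfl) i
  simpa using this

theorem aj_sm1 {f : (Fin 2 → ℝ) → ℝ} (hf : ContDiff ℝ 1 f) (i : Fin 2) :
    Continuous (pd i f) := by
  have := aj_sm (n := 0) (f := f) (by convert hf using 1; norm_num; try rfl) i
  exact this.continuous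

theorem aj_fderiv (f : (Fin 2 → ℝ) → ℝ) (x v : Fin 2 → ℝ) :
    fderiv ℝ f x v = v 0 * pd 0 f x + v 1 * pd 1 f x := by
  have h : v = v 0 • (Pi.single 0 1 : Fin 2 → ℝ) + v 1 • (Pi.single 1 1 : Fin 2 → ℝ) := by
    ext i; fin_cases i <;> simp
  conv_lhs => rw [h]
  rw [map_add, map_smul, map_smul]; rfl

theorem aj_add {f g : (Fin 2 → ℝ) → ℝ} (hf : Differentiable ℝ f) (hg : Differentiable ℝ g)
    (i : Fin 2) (x : Fin 2 → ℝ) : pd i (fun y => f y + g y) x = pd i f x + pd i g x := by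
  unfold pd; rw [fderiv_fun_add (hf x) (hg x)]; rfl

theorem aj_sub {f g : (Fin 2 → ℝ) → ℝ} (hf : Differentiable ℝ f) (hg : Differentiable ℝ g)
    (i : Fin 2) (x : Fin 2 → ℝ) : pd i (fun y => f y - g y) x = pd i f x - pd i g x := by
  unfold pd; rw [fderiv_fun_sub (hf x) (hg x)]; rfl

theorem aj_neg {f : (Fin 2 → ℝ) → ℝ}
    (i : Fin 2) (x : Fin 2 → ℝ) : pd i (fun y => - f y) x = - pd i f x := by
  unfold pd; rw [fderiv_fun_neg]; rfl

theorem aj_mul {f g : (Fin 2 → ℝ) → ℝ} (hf : Differentiable ℝ f) (hg : Differentiable ℝ g)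
    (i : Fin 2) (x : Fin 2 → ℝ) :
    pd i (fun y => f y * g y) x = pd i f x * g x + f x * pd i g x := by
  unfold pd; rw [fderiv_fun_mul (hf x) (hg x)]
  simp; ring

theorem aj_const (c : ℝ) (i : Fin 2) (x : Fin 2 → ℝ) : pd i (fun _ => c) x = 0 := by
  unfold pd; simp

theorem aj_comp {k k' : ℝ → ℝ} {f : (Fin 2 → ℝ) → ℝ} (hf : Differentiable ℝ f)
    (i : Fin 2) (x : Fin 2 → ℝ) (hk : HasDerivAt k (k' (f x)) (f x)) :
    pd i (fun y => k (f y)) x = k' (f x) * pd i f x := by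
  unfold pd
  have := hk.comp_hasFDerivAt x (hf x).hasFDerivAt
  rw [show (fun y => k (f y)) = k ∘ f from rfl, this.fderiv]; simp

theorem aj_inv {f : (Fin 2 → ℝ) → ℝ} (hf : Differentiable ℝ f)
    (i : Fin 2) (x : Fin 2 → ℝ) (h0 : f x ≠ 0) :
    pd i (fun y => (f y)⁻¹) x = - pd i f x / (f x)^2 := by
  rw [aj_comp (k := fun s => s⁻¹) (k' := fun s => -(s^2)⁻¹) hf i x (hasDerivAt_inv h0)]
  field_simp

theorem aj_comm {f : (Fin 2 → ℝ) → ℝ} (hf : ContDiff ℝ 2 f) (x : Fin 2 → ℝ) :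
    pd 1 (pd 0 f) x = pd 0 (pd 1 f) x := by
  have hs : IsSymmSndFDerivAt ℝ f x := (hf.contDiffAt).isSymmSndFDerivAt (by simp)
  have hd : DifferentiableAt ℝ (fderiv ℝ f) x := by
    have : ContDiff ℝ 1 (fderiv ℝ f) := hf.fderiv_right (by norm_num)
    exact (this.differentiable (by norm_num)) x
  have key : ∀ i j : Fin 2, pd i (pd j f) x =
      fderiv ℝ (fderiv ℝ f) x (Pi.single i 1) (Pi.single j 1) := by
    intro i j
    unfold pd
    rw [fderiv_clm_apply hd (by fun_prop)]
    simp
  rw [key, key]; exact hs _ _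

theorem aj_supp {f : (Fin 2 → ℝ) → ℝ} (hc : HasCompactSupport f) (i : Fin 2) :
    HasCompactSupport (pd i f) := by
  have := hc.fderiv (𝕜 := ℝ)
  exact this.comp_left (g := fun L : (Fin 2 → ℝ) →L[ℝ] ℝ => L (Pi.single i 1)) (by simp)

open MeasureTheory in
theorem aj_div0 {f : (Fin 2 → ℝ) → ℝ} (hf : ContDiff ℝ 1 f) (hc : HasCompactSupport f) (i : Fin 2) :
    ∫ x, pd i f x = 0 := by
  have h1 := integral_mul_fderiv_eq_neg_fderiv_mul_of_integrable (μ := (volume : Measure (Fin 2 → ℝ)))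
    (f := fun _ => (1:ℝ)) (g := f) (v := (Pi.single i 1 : Fin 2 → ℝ)) (by simp)
    (by simpa [pd, Function.comp_def] using! ((aj_sm1 hf i).integrable_of_hasCompactSupport (aj_supp hc i)))
    (by simpa using ((hf.continuous).integrable_of_hasCompactSupport hc))
    (by intro x _; fun_prop) (by intro x _; exact (hf.differentiable (by norm_num)) x)
  simpa [pd] using h1

open MeasureTheory in
theorem aj_div {f g : (Fin 2 → ℝ) → ℝ} (hf : ContDiff ℝ 1 f) (hfc : HasCompactSupport f)
    (hg : ContDiff ℝ 1 g) (hgc : HasCompactSupport g) :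
    ∫ x, (pd 0 f x + pd 1 g x) = 0 := by
  rw [integral_add ((aj_sm1 hf 0).integrable_of_hasCompactSupport (aj_supp hfc 0))
    ((aj_sm1 hg 1).integrable_of_hasCompactSupport (aj_supp hgc 1)), aj_div0 hf hfc, aj_div0 hg hgc]
  simp

/-- energy density -/
noncomputable def ajQ (m a b d η : (Fin 2 → ℝ) → ℝ) (x : Fin 2 → ℝ) : ℝ :=
  m x * (d x * (pd 0 η x)^2 - 2 * b x * pd 0 η x * pd 1 η x + a x * (pd 1 η x)^2)

/-- existence of cutoffs with bounded energy -/
def ajCut (m a b d : (Fin 2 → ℝ) → ℝ) (C R : ℝ) : Prop :=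
  ∃ η : (Fin 2 → ℝ) → ℝ, ContDiff ℝ 1 η ∧ HasCompactSupport η ∧ (∀ x, 0 ≤ η x ∧ η x ≤ 1) ∧
    (∀ x, ‖x‖ ≤ R → η x = 1) ∧ ∫ x, ajQ m a b d η x ≤ C

theorem ajQ_cont {m a b d η : (Fin 2 → ℝ) → ℝ} (hm : Continuous m) (ha : Continuous a)
    (hb : Continuous b) (hd : Continuous d) (hη : ContDiff ℝ 1 η) : Continuous (ajQ m a b d η) := by
  unfold ajQ
  have h0 := aj_sm1 hη 0
  have h1 := aj_sm1 hη 1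
  fun_prop

theorem ajQ_supp {m a b d η : (Fin 2 → ℝ) → ℝ} (hc : HasCompactSupport η) :
    HasCompactSupport (ajQ m a b d η) := by
  apply HasCompactSupport.intro (hc.fderiv (𝕜 := ℝ))
  intro x hx
  have : fderiv ℝ η x = 0 := image_eq_zero_of_notMem_tsupport hx
  simp [ajQ, pd, this]

open MeasureTheory in
theorem ajQ_int {m a b d η : (Fin 2 → ℝ) → ℝ} (hm : Continuous m) (ha : Continuous a)
    (hb : Continuous b) (hd : Continuous d) (hη : ContDiff ℝ 1 η) (hc : HasCompactSupport η) :
    Integrable (ajQ m a b d η) :=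
  (ajQ_cont hm ha hb hd hη).integrable_of_hasCompactSupport (ajQ_supp hc)

theorem aj_young {η s q M C1 t : ℝ} (hq : 0 ≤ q) (hM : 0 ≤ C1 * M) (ht : 0 < t)
    (h : s^2 ≤ C1 * q * M) : 2 * η * s ≤ t * (C1 * M) + η^2 * q / t := by
  have hB : 0 ≤ η^2 * q / t := by positivity
  have hA : 0 ≤ t * (C1 * M) := by positivity
  apply le_of_abs_le
  apply abs_le_of_sq_le_sq _ (by positivity)
  have e : (t * (C1 * M)) * (η^2 * q / t) = η^2 * (C1 * q * M) := by field_simp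
  have : η^2 * s^2 ≤ η^2 * (C1 * q * M) := by gcongr
  nlinarith [sq_nonneg (t * (C1 * M) - η^2 * q / t)]

open MeasureTheory Metric in
theorem aj_liouville {m a b d Z0 Z1 q : (Fin 2 → ℝ) → ℝ} {C1 C : ℝ}
    (hm : Continuous m) (ha : Continuous a)
    (hb : Continuous b) (hd : Continuous d) (hZ0 : ContDiff ℝ 1 Z0) (hZ1 : ContDiff ℝ 1 Z1)
    (hq : Continuous q) (hq0 : ∀ x, 0 ≤ q x) (hC1 : 0 ≤ C1)
    (hdiv : ∀ x, pd 0 Z0 x + pd 1 Z1 x = - q x)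
    (hM : ∀ x ξ ζ, 0 ≤ m x * (d x * ξ^2 - 2 * b x * ξ * ζ + a x * ζ^2))
    (hCS : ∀ x ξ ζ, (Z0 x * ξ + Z1 x * ζ)^2 ≤
      C1 * q x * (m x * (d x * ξ^2 - 2 * b x * ξ * ζ + a x * ζ^2)))
    (hcut : ∀ R, ajCut m a b d C R) : ∀ x, q x = 0 := by
  -- basic identity
  have hbasic : ∀ η : (Fin 2 → ℝ) → ℝ, ContDiff ℝ 1 η → HasCompactSupport η →
      Integrable (fun x => η x ^ 2 * q x) ∧
      Integrable (fun x => 2 * η x * (Z0 x * pd 0 η x + Z1 x * pd 1 η x)) ∧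
      ∫ x, η x ^ 2 * q x = ∫ x, 2 * η x * (Z0 x * pd 0 η x + Z1 x * pd 1 η x) := by
    intro η h1 hc
    have hdη : Differentiable ℝ η := h1.differentiable (by norm_num)
    have hdZ0 : Differentiable ℝ Z0 := hZ0.differentiable (by norm_num)
    have hdZ1 : Differentiable ℝ Z1 := hZ1.differentiable (by norm_num)
    have hi1 : Integrable (fun x => η x ^ 2 * q x) := by
      apply Continuous.integrable_of_hasCompactSupport
      · have := h1.continuous; fun_prop
      · exact HasCompactSupport.intro hc (fun x hx => by simp [image_eq_zero_of_notMem_tsupport hx])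
    have hi2 : Integrable (fun x => 2 * η x * (Z0 x * pd 0 η x + Z1 x * pd 1 η x)) := by
      apply Continuous.integrable_of_hasCompactSupport
      · have := h1.continuous
        have := aj_sm1 h1 0
        have := aj_sm1 h1 1
        have := hZ0.continuous
        have := hZ1.continuous
        fun_prop
      · exact HasCompactSupport.intro hc (fun x hx => by simp [image_eq_zero_of_notMem_tsupport hx])
    have := aj_div (f := fun x => (η x * η x) * Z0 x) (g := fun x => (η x * η x) * Z1 x)
      (by fun_prop)
      (HasCompactSupport.intro hc (fun x hx => by simp [image_eq_zero_of_notMem_tsupport hx]))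
      (by fun_prop)
      (HasCompactSupport.intro hc (fun x hx => by simp [image_eq_zero_of_notMem_tsupport hx]))
    have e : ∀ x, pd 0 (fun x => (η x * η x) * Z0 x) x + pd 1 (fun x => (η x * η x) * Z1 x) x =
        2 * η x * (Z0 x * pd 0 η x + Z1 x * pd 1 η x) - η x ^ 2 * q x := by
      intro x
      rw [aj_mul (hdη.fun_mul hdη) hdZ0, aj_mul (hdη.fun_mul hdη) hdZ1, aj_mul hdη hdη,
        aj_mul hdη hdη]
      linear_combination (η x * η x) * hdiv x
    refine ⟨hi1, hi2, ?_⟩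
    simp_rw [e] at this
    rw [integral_sub hi2 hi1] at this
    linarith
  have hcov : AECover (volume : Measure (Fin 2 → ℝ)) atTop (fun n : ℕ => ball (0 : Fin 2 → ℝ) n) :=
    aecover_ball tendsto_natCast_atTop_atTop
  have hC : 0 ≤ C := by
    obtain ⟨η, h1, hc, h01, hR, hE⟩ := hcut 0
    exact le_trans (integral_nonneg fun x => hM x _ _) hE
  have hlow : ∀ (η : (Fin 2 → ℝ) → ℝ) (n : ℕ), Integrable (fun x => η x ^ 2 * q x) →
      (∀ x, ‖x‖ ≤ (n:ℝ) → η x = 1) → ∫ x in ball 0 (n:ℝ), q x ≤ ∫ x, η x ^ 2 * q x := by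
    intro η n hi hR
    have : ∫ x in ball 0 (n:ℝ), q x = ∫ x in ball 0 (n:ℝ), η x ^ 2 * q x := by
      apply setIntegral_congr_fun measurableSet_ball
      intro x hx
      simp [hR x (by simpa using (mem_ball_zero_iff.1 hx).le)]
    rw [this]
    exact setIntegral_le_integral hi (Filter.Eventually.of_forall fun x =>
      mul_nonneg (sq_nonneg _) (hq0 x))
  -- integrability
  have hqint : Integrable q := by
    apply hcov.integrable_of_integral_bounded_of_nonneg_ae (4 * C1 * C)
    · intro n
      exact (hq.continuousOn.integrableOn_compact (isCompact_closedBall 0 (n:ℝ))).mono_set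
        ball_subset_closedBall
    · exact Filter.Eventually.of_forall hq0
    · refine Filter.Eventually.of_forall fun n => ?_
      obtain ⟨η, h1, hc, h01, hR, hE⟩ := hcut n
      obtain ⟨hi1, hi2, hb1⟩ := hbasic η h1 hc
      have hi3 := ajQ_int hm ha hb hd h1 hc
      have h2 : ∫ x, 2 * η x * (Z0 x * pd 0 η x + Z1 x * pd 1 η x) ≤
          ∫ x, (2 * C1 * ajQ m a b d η x + (1/2) * (η x ^ 2 * q x)) := by
        apply integral_mono hi2 ((hi3.const_mul _).add (hi1.const_mul _))
        intro x
        have := aj_young (η := η x) (hq0 x) (mul_nonneg hC1 (hM x (pd 0 η x) (pd 1 η x)))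
          (two_pos) (hCS x (pd 0 η x) (pd 1 η x))
        simp only [ajQ, Pi.add_apply]
        linarith
      rw [integral_add (hi3.const_mul _) (hi1.const_mul _), integral_const_mul,
        integral_const_mul] at h2
      have h3 : ∫ x in ball 0 (n:ℝ), q x ≤ ∫ x, η x ^ 2 * q x := hlow η n hi1 hR
      have h4 : 2 * C1 * ∫ x, ajQ m a b d η x ≤ 2 * C1 * C := by gcongr
      linarith
  have key : ∀ t : ℝ, 0 < t → ∀ n : ℕ, ∫ x in ball 0 (n:ℝ), q x ≤
      t * (C1 * C) + ((∫ x, q x) - ∫ x in ball 0 (n:ℝ), q x) / t := by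
    intro t ht n
    obtain ⟨η, h1, hc, h01, hR, hE⟩ := hcut n
    obtain ⟨hi1, hi2, hb1⟩ := hbasic η h1 hc
    have hi3 := ajQ_int hm ha hb hd h1 hc
    have hi4 : Integrable ((ball (0 : Fin 2 → ℝ) (n:ℝ))ᶜ.indicator q) :=
      hqint.indicator measurableSet_ball.compl
    have h2 : ∫ x, 2 * η x * (Z0 x * pd 0 η x + Z1 x * pd 1 η x) ≤
          ∫ x, (t * C1 * ajQ m a b d η x + (1/t) * ((ball (0 : Fin 2 → ℝ) (n:ℝ))ᶜ.indicator q x)) := by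
      apply integral_mono hi2 ((hi3.const_mul _).add (hi4.const_mul _))
      intro x
      by_cases hx : x ∈ ball (0 : Fin 2 → ℝ) (n:ℝ)
      · have hz : fderiv ℝ η x = 0 := by
          have : η =ᶠ[𝓝 x] fun _ => 1 := by
            filter_upwards [isOpen_ball.mem_nhds hx] with y hy
            exact hR y (by simpa using (mem_ball_zero_iff.1 hy).le)
          rw [this.fderiv_eq]; simp
        simp [ajQ, pd, hz, hx]
      · have := aj_young (η := η x) (hq0 x) (mul_nonneg hC1 (hM x (pd 0 η x) (pd 1 η x)))
          ht (hCS x (pd 0 η x) (pd 1 η x))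
        have h5 : η x ^ 2 * q x / t ≤ 1 / t * q x := by
          have : η x ^ 2 ≤ 1 := by have := h01 x; nlinarith
          have : η x ^ 2 * q x ≤ 1 * q x := mul_le_mul_of_nonneg_right this (hq0 x)
          calc η x ^ 2 * q x / t ≤ (1 * q x) / t := by gcongr
            _ = _ := by ring
        simp only [ajQ, Pi.add_apply, Set.indicator_of_mem (Set.mem_compl hx)]
        linarith
    rw [integral_add (hi3.const_mul _) (hi4.const_mul _), integral_const_mul,
        integral_const_mul, integral_indicator measurableSet_ball.compl] at h2
    have h3 : ∫ x in ball 0 (n:ℝ), q x ≤ ∫ x, η x ^ 2 * q x := hlow η n hi1 hR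
    have h4 : t * C1 * ∫ x, ajQ m a b d η x ≤ t * C1 * C := by gcongr
    have h5 := integral_add_compl (measurableSet_ball (x := (0 : Fin 2 → ℝ)) (ε := (n:ℝ))) hqint
    have h6 : ((∫ x, q x) - ∫ x in ball 0 (n:ℝ), q x) / t =
      1 / t * ∫ x in (ball (0 : Fin 2 → ℝ) (n:ℝ))ᶜ, q x := by rw [← h5]; ring
    rw [h6]
    linarith
  have hlim := hcov.integral_tendsto_of_countably_generated hqint
  have h3 : ∀ t : ℝ, 0 < t → ∫ x, q x ≤ t * (C1 * C) := by
    intro t ht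
    have hl : Tendsto (fun n : ℕ => t * (C1 * C) + ((∫ x, q x) - ∫ x in ball 0 (n:ℝ), q x) / t) atTop
        (𝓝 (t * (C1 * C) + ((∫ x, q x) - ∫ x, q x) / t)) :=
      ((hlim.const_sub _).div_const t).const_add _
    have := le_of_tendsto_of_tendsto' hlim hl (key t ht)
    simpa using this
  have h4 : ∫ x, q x ≤ 0 := by
    have : Tendsto (fun t : ℝ => t * (C1 * C)) (𝓝[>] 0) (𝓝 (0 * (C1 * C))) :=
      ((continuous_id.mul continuous_const).tendsto 0).mono_left nhdsWithin_le_nhds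
    rw [zero_mul] at this
    exact ge_of_tendsto this (eventually_nhdsWithin_of_forall fun t ht => h3 t ht)
  have h5 : ∫ x, q x = 0 := le_antisymm h4 (integral_nonneg hq0)
  rw [integral_eq_zero_iff_of_nonneg hq0 hqint] at h5
  have := (Continuous.ae_eq_iff_eq volume hq continuous_zero).1 h5
  intro x; simp [this]

theorem ajI_diff {g : (Fin 2 → ℝ) → ℝ} (h : ContDiff ℝ (⊤ : ℕ∞) g) : Differentiable ℝ g :=
  h.differentiable (by simp)

theorem ajI_1 {g : (Fin 2 → ℝ) → ℝ} (h : ContDiff ℝ (⊤ : ℕ∞) g) : ContDiff ℝ 1 g :=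
  h.of_le (by exact_mod_cast le_top)

theorem ajI_2 {g : (Fin 2 → ℝ) → ℝ} (h : ContDiff ℝ (⊤ : ℕ∞) g) : ContDiff ℝ 2 g :=
  h.of_le (by
    have : ((2 : ℕ∞) : WithTop ℕ∞) ≤ ((⊤ : ℕ∞) : WithTop ℕ∞) := by exact_mod_cast le_top
    exact this)

theorem aj_qpos {a b d ξ ζ : ℝ} (ha : 0 < a) (hS : 0 < a * d - b^2) :
    0 ≤ d * ξ^2 - 2 * b * ξ * ζ + a * ζ^2 := by
  have : a * (d * ξ^2 - 2 * b * ξ * ζ + a * ζ^2) = (a * ζ - b * ξ)^2 + (a*d-b^2) * ξ^2 := by ring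
  have h2 : 0 ≤ a * (d * ξ^2 - 2 * b * ξ * ζ + a * ζ^2) := by rw [this]; positivity
  exact nonneg_of_mul_nonneg_right h2 ha

theorem aj_qzero {a b d ξ ζ : ℝ} (ha : 0 < a) (hS : 0 < a * d - b^2)
    (h : d * ξ^2 - 2 * b * ξ * ζ + a * ζ^2 = 0) : ξ = 0 ∧ ζ = 0 := by
  have : (a * ζ - b * ξ)^2 + (a*d-b^2) * ξ^2 = 0 := by linear_combination a * h
  have h1 : (a*d-b^2) * ξ^2 = 0 := by
    have : 0 ≤ (a*d-b^2) * ξ^2 := by positivity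
    nlinarith [sq_nonneg (a * ζ - b * ξ)]
  have h2 : ξ = 0 := by
    rcases mul_eq_zero.1 h1 with h | h
    · linarith
    · exact pow_eq_zero_iff (two_ne_zero) |>.1 h
  subst h2
  refine ⟨rfl, ?_⟩
  have : a * ζ^2 = 0 := by linarith
  rcases mul_eq_zero.1 this with h | h
  · linarith
  · exact pow_eq_zero_iff (two_ne_zero) |>.1 h

theorem aj_K1 {a b d p : (Fin 2 → ℝ) → ℝ} {C : ℝ} (ha : ContDiff ℝ (⊤ : ℕ∞) a)
    (hb : ContDiff ℝ (⊤ : ℕ∞) b) (hd : ContDiff ℝ (⊤ : ℕ∞) d) (hp : ContDiff ℝ (⊤ : ℕ∞) p)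
    (hab : ∀ x, pd 1 a x = pd 0 b x) (hbd : ∀ x, pd 1 b x = pd 0 d x)
    (ha0 : ∀ x, 0 < a x) (hS : ∀ x, 0 < a x * d x - b x ^ 2) (hp0 : ∀ x, 0 < p x)
    (hpde : ∀ x, d x * pd 0 (pd 0 p) x - 2 * b x * pd 0 (pd 1 p) x + a x * pd 1 (pd 1 p) x = 0)
    (hcut : ∀ R, ajCut (fun _ => 1) a b d C R) : ∀ x, pd 0 p x = 0 ∧ pd 1 p x = 0 := by
  have hr : ContDiff ℝ (⊤ : ℕ∞) (fun x => (p x)⁻¹) := hp.inv (fun x => (hp0 x).ne')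
  have h0 := aj_smI hp 0
  have h1 := aj_smI hp 1
  have hX0 : ContDiff ℝ (⊤ : ℕ∞) (fun x => d x * pd 0 p x - b x * pd 1 p x) := by fun_prop
  have hX1 : ContDiff ℝ (⊤ : ℕ∞) (fun x => a x * pd 1 p x - b x * pd 0 p x) := by fun_prop
  have key := aj_liouville (m := fun _ => 1) (a := a) (b := b) (d := d) (C1 := 1) (C := C)
    (Z0 := fun x => (d x * pd 0 p x - b x * pd 1 p x) * (p x)⁻¹)
    (Z1 := fun x => (a x * pd 1 p x - b x * pd 0 p x) * (p x)⁻¹)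
    (q := fun x => (d x * (pd 0 p x)^2 - 2 * b x * pd 0 p x * pd 1 p x + a x * (pd 1 p x)^2) *
      ((p x)⁻¹)^2)
    (by fun_prop) ha.continuous hb.continuous hd.continuous (ajI_1 (hX0.mul hr))
    (ajI_1 (hX1.mul hr))
    (by
      have := ha.continuous; have := hb.continuous; have := hd.continuous
      have := hr.continuous; have := h0.continuous; have := h1.continuous
      fun_prop)
    (fun x => mul_nonneg (aj_qpos (ha0 x) (hS x)) (by positivity)) zero_le_one
    (by
      intro x
      rw [aj_mul (ajI_diff hX0) (ajI_diff hr), aj_mul (ajI_diff hX1) (ajI_diff hr),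
        aj_sub ((ajI_diff hd).fun_mul (ajI_diff h0)) ((ajI_diff hb).fun_mul (ajI_diff h1)),
        aj_sub ((ajI_diff ha).fun_mul (ajI_diff h1)) ((ajI_diff hb).fun_mul (ajI_diff h0)),
        aj_mul (ajI_diff hd) (ajI_diff h0), aj_mul (ajI_diff hb) (ajI_diff h1),
        aj_mul (ajI_diff ha) (ajI_diff h1), aj_mul (ajI_diff hb) (ajI_diff h0),
        aj_inv (ajI_diff hp) 0 x (hp0 x).ne', aj_inv (ajI_diff hp) 1 x (hp0 x).ne',
        aj_comm (ajI_2 hp), hab, hbd]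
      linear_combination (p x)⁻¹ * hpde x)
    (by intro x ξ ζ; simpa using aj_qpos (ha0 x) (hS x))
    (by
      intro x ξ ζ
      have hs := mul_nonneg (hS x).le (sq_nonneg (pd 0 p x * ζ - pd 1 p x * ξ))
      have h2 : 0 ≤ ((p x)⁻¹)^2 * ((a x * d x - b x ^ 2) * (pd 0 p x * ζ - pd 1 p x * ξ)^2) := by
        positivity
      linarith)
    hcut
  intro x
  have h2 := key x
  have h3 : ((p x)⁻¹)^2 ≠ 0 := by have := hp0 x; positivity
  exact aj_qzero (ha0 x) (hS x) ((mul_eq_zero.1 h2).resolve_right h3)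

theorem aj_prim {u v : (Fin 2 → ℝ) → ℝ} (hu : ContDiff ℝ (⊤ : ℕ∞) u) (hv : ContDiff ℝ (⊤ : ℕ∞) v)
    (huv : ∀ x, pd 1 u x = pd 0 v x) :
    ∃ H : (Fin 2 → ℝ) → ℝ, ContDiff ℝ (⊤ : ℕ∞) H ∧ (∀ x, pd 0 H x = u x) ∧ ∀ x, pd 1 H x = v x := by
  let ω : (Fin 2 → ℝ) → ((Fin 2 → ℝ) →L[ℝ] ℝ) := fun x =>
    u x • ContinuousLinearMap.proj 0 + v x • ContinuousLinearMap.proj 1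
  have hω : ContDiff ℝ (⊤ : ℕ∞) ω := by
    exact (hu.smul contDiff_const).add (hv.smul contDiff_const)
  have hωd : Differentiable ℝ ω := hω.differentiable (by simp)
  have hfd : ∀ a x y, fderiv ℝ ω a x y = fderiv ℝ u a x * y 0 + fderiv ℝ v a x * y 1 := by
    intro a x y
    have h1 : HasFDerivAt ω ((fderiv ℝ u a).smulRight (ContinuousLinearMap.proj 0 : (Fin 2 → ℝ) →L[ℝ] ℝ)
      + (fderiv ℝ v a).smulRight (ContinuousLinearMap.proj 1 : (Fin 2 → ℝ) →L[ℝ] ℝ)) a :=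
      ((ajI_diff hu a).hasFDerivAt.smul_const _).add ((ajI_diff hv a).hasFDerivAt.smul_const (ContinuousLinearMap.proj 1 : (Fin 2 → ℝ) →L[ℝ] ℝ))
    rw [h1.fderiv]
    simp
  obtain ⟨H, hH⟩ := Convex.exists_forall_hasFDerivAt_of_fderiv_symmetric (ω := ω) (convex_univ (𝕜 := ℝ))
    isOpen_univ hωd.differentiableOn (by
      intro a _ x y
      rw [hfd, hfd, aj_fderiv u, aj_fderiv v, aj_fderiv u, aj_fderiv v, huv]
      ring)
  have hH' : fderiv ℝ H = ω := funext fun x => (hH x trivial).fderiv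
  refine ⟨H, ?_, ?_, ?_⟩
  · rw [contDiff_infty_iff_fderiv]
    refine ⟨fun x => (hH x trivial).differentiableAt, ?_⟩
    rw [hH']; exact hω
  · intro x; simp [pd, hH', ω]
  · intro x; simp [pd, hH', ω]

theorem aj_K0 {a b d w : (Fin 2 → ℝ) → ℝ} {C : ℝ} (ha : ContDiff ℝ (⊤ : ℕ∞) a)
    (hb : ContDiff ℝ (⊤ : ℕ∞) b) (hd : ContDiff ℝ (⊤ : ℕ∞) d) (hw : ContDiff ℝ (⊤ : ℕ∞) w)
    (hab : ∀ x, pd 1 a x = pd 0 b x) (hbd : ∀ x, pd 1 b x = pd 0 d x)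
    (ha0 : ∀ x, 0 < a x) (hS : ∀ x, 0 < a x * d x - b x ^ 2) (hw0 : ∀ x, 0 < w x)
    (hwS : ∀ x, w x * (a x * d x - b x ^ 2) = 1)
    (hpde : ∀ x, d x * pd 0 (pd 0 w) x - 2 * b x * pd 0 (pd 1 w) x + a x * pd 1 (pd 1 w) x = 0)
    (hcut : ∀ R, ajCut w a b d C R) : ∀ x, pd 0 w x = 0 ∧ pd 1 w x = 0 := by
  have h0 := aj_smI hw 0
  have h1 := aj_smI hw 1
  have dw := ajI_diff hw
  have da := ajI_diff ha
  have db := ajI_diff hb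
  have dd := ajI_diff hd
  have d0 := ajI_diff h0
  have d1 := ajI_diff h1
  obtain ⟨H, hH, hH0, hH1⟩ := aj_prim (u := fun x => (1/2) * (a x * pd 1 w x - b x * pd 0 w x))
    (v := fun x => (1/2) * (b x * pd 1 w x - d x * pd 0 w x)) (by fun_prop) (by fun_prop) (by
      intro x
      rw [aj_mul (by fun_prop) (by fun_prop), aj_mul (by fun_prop) (by fun_prop),
        aj_sub (da.fun_mul d1) (db.fun_mul d0), aj_sub (db.fun_mul d1) (dd.fun_mul d0),
        aj_mul da d1, aj_mul db d0, aj_mul db d1, aj_mul dd d0, aj_const, aj_const,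
        aj_comm (ajI_2 hw), hab, hbd]
      linear_combination (1/2) * hpde x)
  have dH := ajI_diff hH
  have hN : ContDiff ℝ (⊤ : ℕ∞) (fun x => w x + H x * H x) := by fun_prop
  have dN := ajI_diff hN
  have hN0 : ∀ x, 0 < w x + H x * H x := fun x => by nlinarith [hw0 x, mul_self_nonneg (H x)]
  have hr : ContDiff ℝ (⊤ : ℕ∞) (fun x => (w x + H x * H x)⁻¹) := hN.inv (fun x => (hN0 x).ne')
  have hX0 : ContDiff ℝ (⊤ : ℕ∞) (fun x => d x * pd 0 w x - b x * pd 1 w x) := by fun_prop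
  have hX1 : ContDiff ℝ (⊤ : ℕ∞) (fun x => a x * pd 1 w x - b x * pd 0 w x) := by fun_prop
  have hY0 : ContDiff ℝ (⊤ : ℕ∞) (fun x => -(w x * (d x * pd 0 w x - b x * pd 1 w x) + H x * pd 1 w x)) := by fun_prop
  have hY1 : ContDiff ℝ (⊤ : ℕ∞) (fun x => -(w x * (a x * pd 1 w x - b x * pd 0 w x) - H x * pd 0 w x)) := by fun_prop
  have key := aj_liouville (m := w) (a := a) (b := b) (d := d) (C1 := 2) (C := C)
    (Z0 := fun x => -(w x * (d x * pd 0 w x - b x * pd 1 w x) + H x * pd 1 w x) * (w x + H x * H x)⁻¹)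
    (Z1 := fun x => -(w x * (a x * pd 1 w x - b x * pd 0 w x) - H x * pd 0 w x) * (w x + H x * H x)⁻¹)
    (q := fun x => (d x * (pd 0 w x)^2 - 2 * b x * pd 0 w x * pd 1 w x + a x * (pd 1 w x)^2) *
      ((1/2) * (w x + H x * H x)⁻¹))
    hw.continuous ha.continuous hb.continuous hd.continuous (ajI_1 (hY0.mul hr))
    (ajI_1 (hY1.mul hr))
    (by
      have := ha.continuous; have := hb.continuous; have := hd.continuous
      have := hr.continuous; have := h0.continuous; have := h1.continuous
      fun_prop)
    (fun x => mul_nonneg (aj_qpos (ha0 x) (hS x)) (by have := hN0 x; positivity)) zero_le_two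
    (by
      intro x
      rw [aj_mul (ajI_diff hY0) (ajI_diff hr), aj_mul (ajI_diff hY1) (ajI_diff hr),
        aj_neg, aj_neg,
        aj_add (dw.fun_mul (ajI_diff hX0)) (dH.fun_mul d1), aj_sub (dw.fun_mul (ajI_diff hX1)) (dH.fun_mul d0),
        aj_mul dw (ajI_diff hX0), aj_mul dw (ajI_diff hX1), aj_mul dH d1, aj_mul dH d0,
        aj_sub (dd.fun_mul d0) (db.fun_mul d1),
        aj_sub (da.fun_mul d1) (db.fun_mul d0),
        aj_mul dd d0, aj_mul db d1, aj_mul da d1, aj_mul db d0,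
        aj_inv dN 0 x (hN0 x).ne', aj_inv dN 1 x (hN0 x).ne',
        aj_add dw (dH.fun_mul dH), aj_add dw (dH.fun_mul dH), aj_mul dH dH, aj_mul dH dH,
        aj_comm (ajI_2 hw), hab, hbd, hH0, hH1]
      have hR : (w x + H x * H x) * (w x + H x * H x)⁻¹ = 1 := mul_inv_cancel₀ (hN0 x).ne'
      simp only [div_eq_mul_inv, ← inv_pow]
      generalize (w x + H x * H x)⁻¹ = R at *
      linear_combination (-(w x) * R) * hpde x +
        ((d x * (pd 0 w x)^2 - 2 * b x * pd 0 w x * pd 1 w x + a x * (pd 1 w x)^2) * R) * hR)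
    (by intro x ξ ζ; exact mul_nonneg (hw0 x).le (aj_qpos (ha0 x) (hS x)))
    (by
      intro x ξ ζ
      have hw1 := hwS x
      set X0 := (w x * (d x * pd 0 w x - b x * pd 1 w x) + H x * pd 1 w x) with hX0
      set X1 := (w x * (a x * pd 1 w x - b x * pd 0 w x) - H x * pd 0 w x) with hX1
      have hn := (hN0 x)
      have e1 : a x * X0^2 + 2 * b x * X0 * X1 + d x * X1^2 = (w x + H x * H x) *
        (d x * (pd 0 w x)^2 - 2 * b x * pd 0 w x * pd 1 w x + a x * (pd 1 w x)^2) := by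
        rw [hX0, hX1]
        linear_combination (w x * (d x * (pd 0 w x)^2 - 2 * b x * pd 0 w x * pd 1 w x + a x * (pd 1 w x)^2)) * hw1
      have e2 : (X0 * ξ + X1 * ζ)^2 ≤ (a x * X0^2 + 2 * b x * X0 * X1 + d x * X1^2) *
         (w x * (d x * ξ ^ 2 - 2 * b x * ξ * ζ + a x * ζ ^ 2)) := by
        have : 0 ≤ w x * ((b x * X0 + d x * X1) * ξ - (a x * X0 + b x * X1) * ζ)^2 := by
          have := hw0 x; positivity
        have e : (X0 * ξ + X1 * ζ)^2 = (w x * (a x * d x - b x ^ 2)) * (X0 * ξ + X1 * ζ)^2 := by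
          rw [hw1]; ring
        rw [e]; linarith
      have e3 : (-X0 * (w x + H x * H x)⁻¹ * ξ + -X1 * (w x + H x * H x)⁻¹ * ζ)^2 =
        (X0 * ξ + X1 * ζ)^2 * ((w x + H x * H x)⁻¹)^2 := by ring
      rw [e3]
      calc (X0 * ξ + X1 * ζ)^2 * ((w x + H x * H x)⁻¹)^2 ≤ ((a x * X0^2 + 2 * b x * X0 * X1 + d x * X1^2) *
         (w x * (d x * ξ ^ 2 - 2 * b x * ξ * ζ + a x * ζ ^ 2))) * ((w x + H x * H x)⁻¹)^2 := by gcongr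
        _ = _ := by rw [e1]; field_simp)
    hcut
  intro x
  have h2 := key x
  have h3 : (1/2) * (w x + H x * H x)⁻¹ ≠ 0 := by have := hN0 x; positivity
  exact aj_qzero (ha0 x) (hS x) ((mul_eq_zero.1 h2).resolve_right h3)

theorem aj_zero_const {g : (Fin 2 → ℝ) → ℝ} (h : Differentiable ℝ g)
    (hz : ∀ x, pd 0 g x = 0 ∧ pd 1 g x = 0) (x : Fin 2 → ℝ) : g x = g 0 := by
  apply is_const_of_fderiv_eq_zero (𝕜 := ℝ) h
  intro y
  ext1 v
  rw [aj_fderiv, (hz y).1, (hz y).2]; simp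

/-- equation for the inverse -/
theorem aj_invL {a b d a' : (Fin 2 → ℝ) → ℝ} (hp : ContDiff ℝ (⊤ : ℕ∞) a') (hp0 : ∀ x, 0 < a' x)
    (h : ∀ x, a' x * (d x * pd 0 (pd 0 a') x - 2 * b x * pd 0 (pd 1 a') x + a x * pd 1 (pd 1 a') x) =
      2 * (d x * (pd 0 a' x)^2 - 2 * b x * pd 0 a' x * pd 1 a' x + a x * (pd 1 a' x)^2)) (x : Fin 2 → ℝ) :
    d x * pd 0 (pd 0 (fun y => (a' y)⁻¹)) x - 2 * b x * pd 0 (pd 1 (fun y => (a' y)⁻¹)) x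
      + a x * pd 1 (pd 1 (fun y => (a' y)⁻¹)) x = 0 := by
  have hr : ContDiff ℝ (⊤ : ℕ∞) (fun y => (a' y)⁻¹) := hp.inv (fun x => (hp0 x).ne')
  have hf : ∀ i : Fin 2, pd i (fun y => (a' y)⁻¹) =
      fun y => - (pd i a' y * ((a' y)⁻¹ * (a' y)⁻¹)) := by
    intro i; funext y
    rw [aj_inv (ajI_diff hp) i y (hp0 y).ne']
    have := (hp0 y).ne'
    field_simp
  have dr := ajI_diff hr
  have e : ∀ i j : Fin 2, pd i (pd j (fun y => (a' y)⁻¹)) x = 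
      - pd i (pd j a') x * ((a' x)⁻¹)^2 + 2 * pd i a' x * pd j a' x * ((a' x)⁻¹)^3 := by
    intro i j
    rw [hf j, aj_neg, aj_mul (ajI_diff (aj_smI hp j)) (dr.fun_mul dr), aj_mul dr dr, hf i]
    ring
  rw [e, e, e]
  have hR : a' x * (a' x)⁻¹ = 1 := mul_inv_cancel₀ (hp0 x).ne'
  generalize (a' x)⁻¹ = R at *
  linear_combination (-R^3) * h x + (d x * pd 0 (pd 0 a') x - 2 * b x * pd 0 (pd 1 a') x + a x * pd 1 (pd 1 a') x) * R^2 * hR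

theorem aj_jorg {a b d : (Fin 2 → ℝ) → ℝ} {C c : ℝ} (ha : ContDiff ℝ (⊤ : ℕ∞) a)
    (hb : ContDiff ℝ (⊤ : ℕ∞) b) (hd : ContDiff ℝ (⊤ : ℕ∞) d)
    (hab : ∀ x, pd 1 a x = pd 0 b x) (hbd : ∀ x, pd 1 b x = pd 0 d x)
    (ha0 : ∀ x, 0 < a x) (hS : ∀ x, 0 < a x * d x - b x ^ 2)
    (hc : ∀ x, a x * d x - b x * b x = c)
    (hcut : ∀ R, ajCut (fun _ => 1) a b d C R) :
    ∀ x, a x = a 0 ∧ b x = b 0 ∧ d x = d 0 := by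
  have hd0 : ∀ x, 0 < d x := by
    intro x
    have h1 := hS x
    have h2 := ha0 x
    have : 0 < a x * d x := by nlinarith [sq_nonneg (b x)]
    exact pos_of_mul_pos_right this h2.le
  have da := ajI_diff ha
  have db := ajI_diff hb
  have dd := ajI_diff hd
  have dpa := fun i => ajI_diff (aj_smI ha i)
  have dpb := fun i => ajI_diff (aj_smI hb i)
  have dpd := fun i => ajI_diff (aj_smI hd i)
  have hab' : pd 1 a = pd 0 b := funext hab
  have hbd' : pd 1 b = pd 0 d := funext hbd
  have hF : ∀ i x, pd i a x * d x + a x * pd i d x - (pd i b x * b x + b x * pd i b x) = 0 := by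
    intro i x
    have : pd i (fun x => a x * d x - b x * b x) x = 0 := by
      rw [show (fun x => a x * d x - b x * b x) = fun _ => c from funext hc, aj_const]
    rwa [aj_sub (da.fun_mul dd) (db.fun_mul db), aj_mul da dd, aj_mul db db] at this
  have hG : ∀ i x, pd i (pd i a) x * d x + 2 * pd i a x * pd i d x + a x * pd i (pd i d) x
      - 2 * (pd i b x)^2 - 2 * b x * pd i (pd i b) x = 0 := by
    intro i x
    have : pd i (fun x => pd i a x * d x + a x * pd i d x - (pd i b x * b x + b x * pd i b x)) x = 0 := by
      rw [show (fun x => pd i a x * d x + a x * pd i d x - (pd i b x * b x + b x * pd i b x)) =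
        fun _ => 0 from funext (hF i), aj_const]
    rw [aj_sub (((dpa i).fun_mul dd).fun_add (da.fun_mul (dpd i)))
        (((dpb i).fun_mul db).fun_add (db.fun_mul (dpb i))),
      aj_add ((dpa i).fun_mul dd) (da.fun_mul (dpd i)),
      aj_add ((dpb i).fun_mul db) (db.fun_mul (dpb i)),
      aj_mul (dpa i) dd, aj_mul da (dpd i), aj_mul (dpb i) db, aj_mul db (dpb i)] at this
    linear_combination this
  -- second order relations
  have r1 : ∀ x, pd 0 (pd 0 d) x = pd 1 (pd 1 a) x := by
    intro x; rw [hab', ← hbd', aj_comm (ajI_2 hb)]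
  have r2 : ∀ x, pd 0 (pd 0 b) x = pd 0 (pd 1 a) x := by
    intro x; rw [hab']
  have r3 : ∀ x, pd 1 (pd 1 b) x = pd 0 (pd 1 d) x := by
    intro x; rw [hbd', aj_comm (ajI_2 hd)]
  have ka := aj_K1 ha hb hd (ha.inv (fun x => (ha0 x).ne')) hab hbd ha0 hS (fun x => inv_pos.2 (ha0 x))
    (aj_invL (a := a) (b := b) (d := d) ha ha0 (by
      intro x
      have h1 := hF 0 x
      have h2 := hG 0 x
      rw [r1, r2, ← hab] at h2
      rw [← hab] at h1
      linear_combination a x * h2 - 2 * pd 0 a x * h1)) hcut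
  have kd := aj_K1 ha hb hd (hd.inv (fun x => (hd0 x).ne')) hab hbd ha0 hS (fun x => inv_pos.2 (hd0 x))
    (aj_invL (a := a) (b := b) (d := d) hd hd0 (by
      intro x
      have h1 := hF 1 x
      have h2 := hG 1 x
      rw [← r1, r3, hbd] at h2
      rw [hbd] at h1
      linear_combination d x * h2 - 2 * pd 1 d x * h1)) hcut
  have ca : ∀ x, a x = a 0 := fun x => by
    have := aj_zero_const (ajI_diff (ha.inv (fun x => (ha0 x).ne'))) ka x
    exact inv_injective this
  have cd : ∀ x, d x = d 0 := fun x => by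
    have := aj_zero_const (ajI_diff (hd.inv (fun x => (hd0 x).ne'))) kd x
    exact inv_injective this
  have cb : ∀ x, b x = b 0 := by
    apply aj_zero_const db
    intro x
    rw [← hab, hbd, show a = fun _ => a 0 from funext ca, show d = fun _ => d 0 from funext cd]
    simp [aj_const]
  exact fun x => ⟨ca x, cb x, cd x⟩

theorem aj_coord (i j : Fin 2) (x : Fin 2 → ℝ) : pd i (fun y => y j) x = if i = j then 1 else 0 := by
  unfold pd
  have : fderiv ℝ (fun y : Fin 2 → ℝ => y j) x = ContinuousLinearMap.proj j :=
    (ContinuousLinearMap.proj j : (Fin 2 → ℝ) →L[ℝ] ℝ).fderiv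
  rw [this]
  simp [Pi.single_apply, eq_comm]

theorem aj_lin {g : (Fin 2 → ℝ) → ℝ} {α β : ℝ} (hg : Differentiable ℝ g) (h0 : ∀ x, pd 0 g x = α)
    (h1 : ∀ x, pd 1 g x = β) (x : Fin 2 → ℝ) : g x = g 0 + α * x 0 + β * x 1 := by
  have dl : ∀ (c : ℝ) (i : Fin 2), Differentiable ℝ (fun y : Fin 2 → ℝ => c * y i) := by
    intro c i; fun_prop
  have e : ∀ (c : ℝ) (i j : Fin 2) x, pd j (fun y : Fin 2 → ℝ => c * y i) x = if j = i then c else 0 := by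
    intro c i j x
    rw [aj_mul (by fun_prop) (by fun_prop), aj_const, aj_coord]; simp
  have := aj_zero_const (g := fun y => g y - (α * y 0 + β * y 1)) (hg.fun_sub ((dl α 0).fun_add (dl β 1)))
    (by
      intro y
      rw [aj_sub hg ((dl α 0).fun_add (dl β 1)), aj_sub hg ((dl α 0).fun_add (dl β 1)),
        aj_add (dl α 0) (dl β 1), aj_add (dl α 0) (dl β 1), e, e, e, e, h0, h1]
      simp) x
  simp at this
  linarith

theorem aj_quad {f : (Fin 2 → ℝ) → ℝ} (hf : ContDiff ℝ (⊤ : ℕ∞) f)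
    {a b d : ℝ} (ha : ∀ x, pd 0 (pd 0 f) x = a) (hb : ∀ x, pd 0 (pd 1 f) x = b)
    (hd : ∀ x, pd 1 (pd 1 f) x = d) : IsQuadratic f := by
  have d0 := ajI_diff (aj_smI hf 0)
  have d1 := ajI_diff (aj_smI hf 1)
  have h0 := aj_lin d0 ha (fun x => by rw [aj_comm (ajI_2 hf), hb])
  have h1 := aj_lin d1 hb hd
  have dc : ∀ (i : Fin 2), Differentiable ℝ (fun y : Fin 2 → ℝ => y i) := by
    intro i; fun_prop
  have dl : ∀ (c : ℝ) (i j : Fin 2), Differentiable ℝ (fun y : Fin 2 → ℝ => c * (y i * y j)) := by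
    intro c i j; fun_prop
  have e : ∀ (c : ℝ) (i j k : Fin 2) x, pd k (fun y : Fin 2 → ℝ => c * (y i * y j)) x =
      c * ((if k = i then 1 else 0) * x j + x i * (if k = j then 1 else 0)) := by
    intro c i j k x
    rw [aj_mul (by fun_prop) (by fun_prop), aj_const, aj_mul (dc i) (dc j), aj_coord, aj_coord]; simp
  have df := ajI_diff hf
  have A : Differentiable ℝ (fun y : Fin 2 → ℝ => a/2 * (y 0 * y 0) + b * (y 0 * y 1)) :=
    (dl (a/2) 0 0).fun_add (dl b 0 1)
  have hp : ∀ (k : Fin 2) x, pd k (fun y => f y - ((a/2 * (y 0 * y 0) + b * (y 0 * y 1)) + d/2 * (y 1 * y 1))) x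
      = pd k f x - ((a/2 * ((if k = 0 then 1 else 0) * x 0 + x 0 * (if k = 0 then 1 else 0)) +
        b * ((if k = 0 then 1 else 0) * x 1 + x 0 * (if k = 1 then 1 else 0)))
        + d/2 * ((if k = 1 then 1 else 0) * x 1 + x 1 * (if k = 1 then 1 else 0))) := by
    intro k x
    rw [aj_sub df (A.fun_add (dl _ 1 1)), aj_add A (dl _ 1 1), aj_add (dl _ 0 0) (dl _ 0 1), e, e, e]
  have := aj_lin (g := fun y => f y - ((a/2 * (y 0 * y 0) + b * (y 0 * y 1)) + d/2 * (y 1 * y 1)))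
    (α := pd 0 f 0) (β := pd 1 f 0) (df.fun_sub (A.fun_add (dl _ 1 1)))
    (by intro x; rw [hp, h0]; simp; ring) (by intro x; rw [hp, h1]; simp; ring)
  refine ⟨!![a/2, b; 0, d/2], ![pd 0 f 0, pd 1 f 0], f 0, ?_⟩
  intro x
  have := this x
  simp [Fin.sum_univ_two] at this ⊢
  linarith

theorem aj_line_deriv {g : (Fin 2 → ℝ) → ℝ} (hg : Differentiable ℝ g) (x v : Fin 2 → ℝ) (t : ℝ) :
    HasDerivAt (fun t : ℝ => g (x + t • v)) (v 0 * pd 0 g (x + t • v) + v 1 * pd 1 g (x + t • v)) t := by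
  have h1 : HasDerivAt (fun t : ℝ => x + t • v) v t := by
    simpa using ((hasDerivAt_id t).smul_const v).const_add x
  have := (hg (x + t • v)).hasFDerivAt.comp_hasDerivAt t h1
  rw [aj_fderiv] at this
  exact this

theorem aj_line_deriv2 {g : (Fin 2 → ℝ) → ℝ} (hg : ContDiff ℝ (⊤ : ℕ∞) g) (x v : Fin 2 → ℝ) (t : ℝ) :
    deriv^[2] (fun t : ℝ => g (x + t • v)) t =
      v 0 ^ 2 * pd 0 (pd 0 g) (x + t • v) + 2 * v 0 * v 1 * pd 0 (pd 1 g) (x + t • v)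
       + v 1 ^ 2 * pd 1 (pd 1 g) (x + t • v) := by
  have e : deriv (fun t : ℝ => g (x + t • v)) =
      fun t => v 0 * pd 0 g (x + t • v) + v 1 * pd 1 g (x + t • v) :=
    funext fun t => (aj_line_deriv (ajI_diff hg) x v t).deriv
  simp only [Function.iterate_succ, Function.iterate_zero, Function.comp, id, e]
  have h := ((aj_line_deriv (ajI_diff (aj_smI hg 0)) x v t).const_mul (v 0)).add
    ((aj_line_deriv (ajI_diff (aj_smI hg 1)) x v t).const_mul (v 1))
  rw [show (fun t : ℝ => v 0 * pd 0 g (x + t • v) + v 1 * pd 1 g (x + t • v)) =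
    (fun t : ℝ => v 0 * pd 0 g (x + t • v)) + fun t => v 1 * pd 1 g (x + t • v) from rfl,
    h.deriv, aj_comm (ajI_2 hg)]
  ring

theorem aj_sconv {g : (Fin 2 → ℝ) → ℝ} (hg : ContDiff ℝ (⊤ : ℕ∞) g)
    (ha0 : ∀ x, 0 < pd 0 (pd 0 g) x)
    (hS : ∀ x, 0 < pd 0 (pd 0 g) x * pd 1 (pd 1 g) x - pd 0 (pd 1 g) x ^ 2) :
    StrictConvexOn ℝ Set.univ g := by
  refine ⟨convex_univ, ?_⟩
  intro x _ y _ hxy s t hs ht hst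
  set v := y - x with hv
  have hv0 : v ≠ 0 := by rw [hv, sub_ne_zero]; exact hxy.symm
  have hc : StrictConvexOn ℝ Set.univ (fun t : ℝ => g (x + t • v)) := by
    apply strictConvexOn_univ_of_deriv2_pos
    · have := hg.continuous; fun_prop
    · intro τ
      rw [aj_line_deriv2 hg]
      have h1 := aj_qpos (ξ := v 1) (ζ := - v 0) (ha0 (x + τ • v)) (hS (x + τ • v))
      rcases h1.lt_or_eq with h | h
      · linarith
      · exfalso
        obtain ⟨h1, h2⟩ := aj_qzero (ha0 (x + τ • v)) (hS (x + τ • v)) h.symm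
        apply hv0
        ext i; fin_cases i
        · simpa using h2
        · simpa using h1
  have := hc.2 (Set.mem_univ (0:ℝ)) (Set.mem_univ 1) zero_ne_one hs ht hst
  simp only [smul_eq_mul, mul_zero, mul_one, zero_add, zero_smul, add_zero, one_smul] at this
  have e : s • x + t • y = x + t • v := by
    rw [hv, smul_sub, show s = 1 - t by linarith, sub_smul, one_smul]; abel
  rw [e]
  simpa [hv] using this

theorem aj_nonneg {g : (Fin 2 → ℝ) → ℝ} (hg : Differentiable ℝ g) (hc : ConvexOn ℝ Set.univ g)
    (h0 : g 0 = 0) (hp0 : pd 0 g 0 = 0) (hp1 : pd 1 g 0 = 0) (x : Fin 2 → ℝ) : 0 ≤ g x := by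
  by_contra hneg
  push Not at hneg
  have hd := aj_line_deriv hg 0 x 0
  simp only [zero_smul, add_zero, hp0, hp1, mul_zero] at hd
  -- derivative zero but slope ≤ g x < 0
  have h2 := hd.tendsto_slope_zero_right
  simp only [zero_add, zero_smul, h0, sub_zero] at h2
  have h3 : ∀ᶠ t in 𝓝[>] (0:ℝ), t⁻¹ • g (t • x) ≤ g x := by
    have : ∀ᶠ t in 𝓝[>] (0:ℝ), t < 1 := by
      exact nhdsWithin_le_nhds (Iio_mem_nhds one_pos)
    filter_upwards [this, self_mem_nhdsWithin] with t ht1 ht0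
    have ht0 : 0 < t := ht0
    have := hc.2 (Set.mem_univ (0 : Fin 2 → ℝ)) (Set.mem_univ x) (show (0:ℝ) ≤ 1 - t by linarith) ht0.le (by ring)
    simp only [smul_zero, zero_add, h0, smul_eq_mul, mul_zero] at this
    rw [smul_eq_mul, inv_mul_le_iff₀ ht0]
    exact this
  have := le_of_tendsto h2 h3
  linarith

/-- coercivity -/
theorem aj_coercive {g : (Fin 2 → ℝ) → ℝ} (hg : Continuous g) (hc : StrictConvexOn ℝ Set.univ g)
    (h0 : g 0 = 0) (hn : ∀ x, 0 ≤ g x) : ∃ c > 0, ∀ x, 1 ≤ ‖x‖ → c * ‖x‖ ≤ g x := by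
  have hpos : ∀ x, x ≠ 0 → 0 < g x := by
    intro x hx
    have := hc.2 (Set.mem_univ (0 : Fin 2 → ℝ)) (Set.mem_univ x) hx.symm
      (show (0:ℝ) < 1/2 by norm_num) (show (0:ℝ) < 1/2 by norm_num) (by norm_num)
    have h2 := hn ((1/2 : ℝ) • 0 + (1/2 : ℝ) • x)
    simp only [h0, smul_eq_mul] at this
    linarith
  obtain ⟨x0, hx0, hmin⟩ := (isCompact_sphere (0 : Fin 2 → ℝ) 1).exists_isMinOn
    (NormedSpace.sphere_nonempty.2 zero_le_one) hg.continuousOn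
  refine ⟨g x0, hpos x0 ?_, ?_⟩
  · rintro rfl; simp at hx0
  · intro x hx
    have hxp : 0 < ‖x‖ := by linarith
    have h1 : g x0 ≤ g (‖x‖⁻¹ • x) := hmin (by
      simp [norm_smul, hxp.ne'])
    have h2 := hc.convexOn.2 (Set.mem_univ (0 : Fin 2 → ℝ)) (Set.mem_univ x)
      (show (0:ℝ) ≤ 1 - ‖x‖⁻¹ by
          have : ‖x‖⁻¹ ≤ 1 := inv_le_one_of_one_le₀ hx
          linarith) (show (0:ℝ) ≤ ‖x‖⁻¹ by positivity) (by ring)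
    simp only [smul_zero, zero_add, h0, smul_eq_mul, mul_zero] at h2
    have h3 : g x0 ≤ ‖x‖⁻¹ * g x := h1.trans h2
    rw [mul_comm]
    rwa [le_inv_mul_iff₀ hxp] at h3

theorem aj_geom {g : (Fin 2 → ℝ) → ℝ} (hg : Continuous g) (hc : ConvexOn ℝ Set.univ g)
    (h0 : g 0 = 0) (hn : ∀ x, 0 ≤ g x) (hco : ∃ c > 0, ∀ x, 1 ≤ ‖x‖ → c * ‖x‖ ≤ g x)
    {R : ℝ} (hR : 1 ≤ R) :
    ∃ h D a0 a1 b0 b1 : ℝ, 0 < h ∧ 0 < D ∧ D * (a0 * b1 - a1 * b0) = 1 ∧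
      (∀ x : Fin 2 → ℝ, g x + g (-x) ≤ h → |a0 * x 0 + a1 * x 1| ≤ 1 ∧ |b0 * x 0 + b1 * x 1| ≤ 1) ∧
      (∀ x : Fin 2 → ℝ, |a0 * x 0 + a1 * x 1| + |b0 * x 0 + b1 * x 1| ≤ 1 → g x + g (-x) ≤ h) ∧
      (∀ x : Fin 2 → ℝ, ‖x‖ ≤ R → |a0 * x 0 + a1 * x 1| ≤ 1/8 ∧ |b0 * x 0 + b1 * x 1| ≤ 1/8) := by
  obtain ⟨c, hc0, hcx⟩ := hco
  have hgs : Continuous (fun x => g x + g (-x)) := by fun_prop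
  obtain ⟨h1, hh1⟩ := (isCompact_closedBall (0 : Fin 2 → ℝ) (8 * R)).exists_bound_of_continuousOn
    hgs.continuousOn
  set h := max h1 1 with hh
  have hpos : 0 < h := lt_max_of_lt_right one_pos
  set S := {x : Fin 2 → ℝ | g x + g (-x) ≤ h} with hS
  have hball : ∀ x : Fin 2 → ℝ, ‖x‖ ≤ 8 * R → x ∈ S := by
    intro x hx
    have := hh1 x (by simpa using hx)
    exact (le_abs_self _).trans (this.trans (le_max_left _ _))
  have hclosed : IsClosed S := isClosed_le hgs continuous_const
  have hbdd : Bornology.IsBounded S := by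
    apply (Metric.isBounded_closedBall (x := (0 : Fin 2 → ℝ)) (r := max 1 (h / c))).subset
    intro x hx
    rw [mem_closedBall_zero_iff]
    rcases le_total ‖x‖ 1 with hx1 | hx1
    · exact hx1.trans (le_max_left _ _)
    · apply le_max_of_le_right
      rw [le_div_iff₀ hc0]
      have := hcx x hx1
      have h2 := hn (-x)
      have h3 : g x + g (-x) ≤ h := hx
      linarith
  have hcomp : IsCompact S := Metric.isCompact_of_isClosed_isBounded hclosed hbdd
  have hsymm : ∀ x ∈ S, -x ∈ S := by
    intro x hx
    have h3 : g x + g (-x) ≤ h := hx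
    show g (-x) + g (- -x) ≤ h
    rw [neg_neg]; linarith
  have hconv : Convex ℝ S := by
    have : ConvexOn ℝ Set.univ (fun x => g x + g (-x)) := by
      apply hc.add
      refine ⟨convex_univ, ?_⟩
      intro x _ y _ s t hs ht hst
      have := hc.2 (Set.mem_univ (-x)) (Set.mem_univ (-y)) hs ht hst
      rw [show s • -x + t • -y = -(s • x + t • y) by simp only [smul_neg]; abel] at this
      exact this
    simpa [hS] using this.convex_le h
  have h0S : (0 : Fin 2 → ℝ) ∈ S := hball 0 (by simp; linarith)
  obtain ⟨⟨P, Q⟩, hPQ, hmax⟩ := (hcomp.prod hcomp).exists_isMaxOn ⟨(0,0), h0S, h0S⟩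
    (f := fun z : (Fin 2 → ℝ) × (Fin 2 → ℝ) => z.1 0 * z.2 1 - z.1 1 * z.2 0) (by fun_prop)
  obtain ⟨hP, hQ⟩ := hPQ
  simp only at hP hQ
  set D := P 0 * Q 1 - P 1 * Q 0 with hD
  have hmax' : ∀ x ∈ S, ∀ y ∈ S, x 0 * y 1 - x 1 * y 0 ≤ D := fun x hx y hy =>
    hmax (a := (x, y)) ⟨hx, hy⟩
  have hDpos : 0 < D := by
    have := hmax' ![1, 0] (hball _ (by
      rw [pi_norm_le_iff_of_nonneg (by linarith)]
      intro i; fin_cases i <;> simp <;> linarith)) ![0, 1] (hball _ (by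
      rw [pi_norm_le_iff_of_nonneg (by linarith)]
      intro i; fin_cases i <;> simp <;> linarith))
    simp at this; linarith
  have hin : ∀ x, x ∈ S → |Q 1 / D * x 0 + -Q 0 / D * x 1| ≤ 1 ∧ |-P 1 / D * x 0 + P 0 / D * x 1| ≤ 1 := by
    intro x hx
    have e1 : Q 1 / D * x 0 + -Q 0 / D * x 1 = (x 0 * Q 1 - x 1 * Q 0) / D := by ring
    have e2 : -P 1 / D * x 0 + P 0 / D * x 1 = (P 0 * x 1 - P 1 * x 0) / D := by ring
    rw [e1, e2, abs_div, abs_div, abs_of_pos hDpos, div_le_one hDpos, div_le_one hDpos, abs_le, abs_le]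
    have m1 := hmax' x hx Q hQ
    have m2 := hmax' (-x) (hsymm x hx) Q hQ
    have m3 := hmax' P hP x hx
    have m4 := hmax' P hP (-x) (hsymm x hx)
    simp only [Pi.neg_apply] at m2 m4
    refine ⟨⟨?_, ?_⟩, ?_, ?_⟩ <;> linarith
  refine ⟨h, D, Q 1 / D, - Q 0 / D, - P 1 / D, P 0 / D, hpos, hDpos, ?_, hin, ?_, ?_⟩
  · rw [show D * (Q 1 / D * (P 0 / D) - -Q 0 / D * (-P 1 / D)) = (P 0 * Q 1 - P 1 * Q 0) / D by
      field_simp, ← hD]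
    exact div_self hDpos.ne'
  · intro x hx
    set s := Q 1 / D * x 0 + -Q 0 / D * x 1 with hs
    set t := -P 1 / D * x 0 + P 0 / D * x 1 with ht
    have hxe : x = s • P + t • Q := by
      ext i
      have h1 : D * s = Q 1 * x 0 - Q 0 * x 1 := by rw [hs]; field_simp; ring
      have h2 : D * t = - P 1 * x 0 + P 0 * x 1 := by rw [ht]; field_simp
      apply mul_left_cancel₀ hDpos.ne'
      fin_cases i
      · show D * x 0 = D * (s * P 0 + t * Q 0)
        linear_combination (-P 0) * h1 - Q 0 * h2 + x 0 * hD
      · show D * x 1 = D * (s * P 1 + t * Q 1)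
        linear_combination (-P 1) * h1 - Q 1 * h2 + x 1 * hD
    have hsP : ∃ P' ∈ S, s • P = |s| • P' := by
      rcases le_total 0 s with hs | hs
      · exact ⟨P, hP, by rw [abs_of_nonneg hs]⟩
      · exact ⟨-P, hsymm P hP, by rw [abs_of_nonpos hs]; simp⟩
    have htQ : ∃ Q' ∈ S, t • Q = |t| • Q' := by
      rcases le_total 0 t with hs | hs
      · exact ⟨Q, hQ, by rw [abs_of_nonneg hs]⟩
      · exact ⟨-Q, hsymm Q hQ, by rw [abs_of_nonpos hs]; simp⟩
    obtain ⟨P', hP', eP⟩ := hsP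
    obtain ⟨Q', hQ', eQ⟩ := htQ
    have hmem : x ∈ S := by
      rw [hxe, eP, eQ]
      have := hconv.sum_mem (t := Finset.univ) (w := ![1 - |s| - |t|, |s|, |t|]) (z := ![0, P', Q'])
        (by intro i _; fin_cases i <;> simp; linarith) (by simp [Fin.sum_univ_three]; ring) (by intro i _; fin_cases i <;> simp [h0S, hP', hQ'])
      simpa [Fin.sum_univ_three] using this
    exact hmem
  · intro x hx
    have := hin ((8:ℝ) • x) (hball _ (by rw [norm_smul]; simp; linarith))
    simp only [Pi.smul_apply, smul_eq_mul] at this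
    rw [show Q 1 / D * (8 * x 0) + -Q 0 / D * (8 * x 1) = 8 * (Q 1 / D * x 0 + -Q 0 / D * x 1) by ring,
      show -P 1 / D * (8 * x 0) + P 0 / D * (8 * x 1) = 8 * (-P 1 / D * x 0 + P 0 / D * x 1) by ring,
      abs_mul, abs_mul, abs_of_pos (by norm_num : (0:ℝ) < 8)] at this
    constructor <;> linarith [this.1, this.2]

theorem aj_sub_jensen {V ι : Type*} [AddCommGroup V] [Module ℝ V] {g : V → ℝ}
    (hc : ConvexOn ℝ Set.univ g) (h0 : g 0 = 0) (T : Finset ι) (w : ι → ℝ) (x : ι → V)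
    (hw : ∀ i, 0 ≤ w i) (hs : ∑ i ∈ T, w i ≤ 1) :
    g (∑ i ∈ T, w i • x i) ≤ ∑ i ∈ T, w i * g (x i) := by
  have := hc.map_add_sum_le (t := T) (w := w) (p := x) (v := 1 - ∑ i ∈ T, w i) (q := 0)
    (fun i _ => hw i) (by ring) (fun i _ => Set.mem_univ _) (by linarith) (Set.mem_univ _)
  simpa [h0] using this

theorem aj_sep_core {V ι : Type} [AddCommGroup V] [Module ℝ V] [Fintype ι] {g : V → ℝ}
    (hc : ConvexOn ℝ Set.univ g) (h0 : g 0 = 0) (hn : ∀ x, 0 ≤ g x) (α β : V →ₗ[ℝ] ℝ) {h : ℝ}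
    (hh : 0 < h) (hin : ∀ x, g x + g (-x) ≤ h → |α x| ≤ 1 ∧ |β x| ≤ 1)
    (hout : ∀ x, |α x| + |β x| ≤ 1 → g x + g (-x) ≤ h)
    (w : ι → ℝ) (x : ι → V) (s : ι → ℝ) (k : ι → Option (Fin 4))
    (hw : ∀ i, 0 ≤ w i) (hw1 : ∑ i, w i = 1) (hx : ∑ i, w i • x i = 0) (hs : ∑ i, w i * s i = h)
    (hk : ∀ i j, k i = some j → 20 < (![α, -α, β, -β] j) (x i) ∧ g (x i) < s i)
    (hk0 : ∀ i, k i = none → |α (x i)| < 1 ∧ |β (x i)| < 1 ∧ 2 * h < s i) : False := by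
  classical
  have hs0 : ∀ i, 0 ≤ s i := by
    intro i
    rcases hki : k i with _ | j
    · have := (hk0 i hki).2.2; linarith
    · have := (hk i j hki).2; have := hn (x i); linarith
  set G := Finset.univ.filter (fun i => k i = none) with hG
  have hlG : ∑ i ∈ G, w i ≤ 1/2 := by
    have h1 : ∑ i ∈ G, w i * (2 * h) ≤ ∑ i ∈ G, w i * s i := by
      apply Finset.sum_le_sum
      intro i hi
      exact mul_le_mul_of_nonneg_left (hk0 i (by simpa [hG] using hi)).2.2.le (hw i)
    have h2 : ∑ i ∈ G, w i * s i ≤ ∑ i, w i * s i :=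
      Finset.sum_le_sum_of_subset_of_nonneg (Finset.subset_univ _)
        (fun i _ _ => mul_nonneg (hw i) (hs0 i))
    rw [← Finset.sum_mul] at h1
    have h3 : (∑ i ∈ G, w i) * (2 * h) ≤ h := by linarith
    by_contra hcon
    push Not at hcon
    nlinarith
  have hj : ∃ j : Fin 4, 1/8 ≤ ∑ i ∈ Finset.univ.filter (fun i => k i = some j), w i := by
    by_contra hcon
    push Not at hcon
    have e : ∑ i, w i = ∑ o : Option (Fin 4), ∑ i ∈ Finset.univ.filter (fun i => k i = o), w i :=
      (Finset.sum_fiberwise _ _ _).symm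
    rw [Fintype.sum_option, Fin.sum_univ_four] at e
    have := hcon 0; have := hcon 1; have := hcon 2; have := hcon 3
    rw [← hG] at e
    linarith
  obtain ⟨j, hj⟩ := hj
  set T := Finset.univ.filter (fun i => k i = some j) with hT
  set T' := Finset.univ.filter (fun i => ¬ k i = some j ∧ ¬ k i = none) with hT'
  have hsplit : ∀ {M : Type} [AddCommMonoid M] (F : ι → M),
      ∑ i, F i = ∑ i ∈ T, F i + (∑ i ∈ T', F i + ∑ i ∈ G, F i) := by
    intro M _ F
    rw [← Finset.sum_filter_add_sum_filter_not Finset.univ (fun i => k i = some j) F]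
    congr 1
    rw [← Finset.sum_filter_add_sum_filter_not (Finset.univ.filter (fun i => ¬ k i = some j)) (fun i => ¬ k i = none) F]
    rw [Finset.filter_filter, Finset.filter_filter]
    congr 2
    ext i
    simp only [hG, Finset.mem_filter, Finset.mem_univ, true_and, not_not]
    constructor
    · exact fun h => h.2
    · intro h; rw [h]; simp
  have hsub : ∀ A : Finset ι, ∑ i ∈ A, w i ≤ 1 := by
    intro A
    rw [← hw1]
    exact Finset.sum_le_sum_of_subset_of_nonneg (Finset.subset_univ _) (fun i _ _ => hw i)
  have e1 := hsplit (fun i => w i • x i)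
  have e2 := hsplit (fun i => w i * s i)
  rw [hx] at e1
  rw [hs] at e2
  set yp := ∑ i ∈ T, w i • x i with hyp
  set ym := ∑ i ∈ T', w i • x i with hym
  set yG := ∑ i ∈ G, w i • x i with hyG
  have j1 : g yp ≤ ∑ i ∈ T, w i * g (x i) := aj_sub_jensen hc h0 T w x hw (hsub T)
  have j2 : g ym ≤ ∑ i ∈ T', w i * g (x i) := aj_sub_jensen hc h0 T' w x hw (hsub T')
  have j1' : ∑ i ∈ T, w i * g (x i) ≤ ∑ i ∈ T, w i * s i := by
    apply Finset.sum_le_sum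
    intro i hi
    exact mul_le_mul_of_nonneg_left (hk i j (by simpa [hT] using hi)).2.le (hw i)
  have j2' : ∑ i ∈ T', w i * g (x i) ≤ ∑ i ∈ T', w i * s i := by
    apply Finset.sum_le_sum
    intro i hi
    rcases hki : k i with _ | j'
    · simp [hT', hki] at hi
    · exact mul_le_mul_of_nonneg_left (hk i j' hki).2.le (hw i)
  have j3 : 0 ≤ ∑ i ∈ G, w i * s i := Finset.sum_nonneg fun i _ => mul_nonneg (hw i) (hs0 i)
  have hfun : ∀ φ : V →ₗ[ℝ] ℝ, (∀ i ∈ G, |φ (x i)| ≤ 1) → |φ yG| ≤ 1/2 := by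
    intro φ hφ
    rw [hyG, map_sum]
    refine (Finset.abs_sum_le_sum_abs _ _).trans (le_trans ?_ hlG)
    apply Finset.sum_le_sum
    intro i hi
    rw [map_smul, smul_eq_mul, abs_mul, abs_of_nonneg (hw i)]
    exact mul_le_of_le_one_right (hw i) (hφ i hi)
  have fa := hfun α (fun i hi => (hk0 i (by simpa [hG] using hi)).1.le)
  have fb := hfun β (fun i hi => (hk0 i (by simpa [hG] using hi)).2.1.le)
  have gG : g yG ≤ h := by
    have := hout yG (by linarith)
    have := hn (-yG)
    linarith
  have c1 := hc.2 (Set.mem_univ yp) (Set.mem_univ 0) (show (0:ℝ) ≤ 1/2 by norm_num) (show (0:ℝ) ≤ 1/2 by norm_num) (by norm_num)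
  have c2 := hc.2 (Set.mem_univ ym) (Set.mem_univ yG) (show (0:ℝ) ≤ 1/2 by norm_num) (show (0:ℝ) ≤ 1/2 by norm_num) (by norm_num)
  have ey : (1/2:ℝ) • ym + (1/2:ℝ) • yG = -((1/2:ℝ) • yp) := by
    rw [← smul_add, ← smul_neg]
    congr 1
    exact (neg_eq_of_add_eq_zero_right e1.symm).symm
  rw [ey] at c2
  simp only [smul_zero, add_zero, h0, smul_eq_mul, mul_zero] at c1 c2
  have key := hin ((1/2:ℝ) • yp) (by linarith)
  simp only [map_smul, smul_eq_mul, abs_le] at key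
  have lower : 5/2 ≤ (![α, -α, β, -β] j) yp := by
    rw [hyp, map_sum]
    calc (5/2:ℝ) ≤ (∑ i ∈ T, w i) * 20 := by linarith
      _ = ∑ i ∈ T, w i * 20 := Finset.sum_mul _ _ _
      _ ≤ _ := by
        apply Finset.sum_le_sum
        intro i hi
        rw [map_smul, smul_eq_mul]
        exact mul_le_mul_of_nonneg_left (hk i j (by simpa [hT] using hi)).1.le (hw i)
  obtain ⟨⟨k1, k2⟩, k3, k4⟩ := key
  fin_cases j <;> simp at lower <;> linarith

theorem aj_sep {g : (Fin 2 → ℝ) → ℝ} (hgc : Continuous g)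
    (hc : ConvexOn ℝ Set.univ g) (h0 : g 0 = 0) (hn : ∀ x, 0 ≤ g x)
    (α β : (Fin 2 → ℝ) →ₗ[ℝ] ℝ) {h : ℝ}
    (hh : 0 < h) (hin : ∀ x, g x + g (-x) ≤ h → |α x| ≤ 1 ∧ |β x| ≤ 1)
    (hout : ∀ x, |α x| + |β x| ≤ 1 → g x + g (-x) ≤ h) :
    ∃ p : (Fin 2 → ℝ) →ₗ[ℝ] ℝ, (∀ x, (20 < |α x| ∨ 20 < |β x|) → h ≤ g x - p x) ∧
      (∀ x, |α x| < 1 → |β x| < 1 → p x ≤ h) := by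
  have hαc : Continuous α := α.continuous_of_finiteDimensional
  have hβc : Continuous β := β.continuous_of_finiteDimensional
  set ℓ : Fin 4 → ((Fin 2 → ℝ) →ₗ[ℝ] ℝ) := ![α, -α, β, -β] with hℓ
  have hℓc : ∀ j, Continuous (ℓ j) := fun j => (ℓ j).continuous_of_finiteDimensional
  set S : Set ((Fin 2 → ℝ) × ℝ) :=
    (⋃ j : Fin 4, {z | 20 < ℓ j z.1 ∧ g z.1 < z.2}) ∪ {z | |α z.1| < 1 ∧ |β z.1| < 1 ∧ 2 * h < z.2} with hS
  have hSo : IsOpen S := by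
    apply IsOpen.union
    · apply isOpen_iUnion
      intro j
      have := hℓc j
      apply IsOpen.and <;> exact isOpen_lt (by fun_prop) (by fun_prop)
    · apply IsOpen.and
      · exact isOpen_lt (by fun_prop) (by fun_prop)
      · apply IsOpen.and <;> exact isOpen_lt (by fun_prop) (by fun_prop)
  have hnot : ((0 : Fin 2 → ℝ), h) ∉ convexHull ℝ S := by
    intro hmem
    rw [mem_convexHull_iff_exists_fintype] at hmem
    obtain ⟨ι, _, w, z, hw, hw1, hz, hsum⟩ := hmem
    have : ∀ i, ∃ o : Option (Fin 4), (∀ j, o = some j → 20 < ℓ j (z i).1 ∧ g (z i).1 < (z i).2) ∧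
        (o = none → |α (z i).1| < 1 ∧ |β (z i).1| < 1 ∧ 2 * h < (z i).2) := by
      intro i
      rcases hz i with hi | hi
      · simp only [Set.mem_iUnion] at hi
        obtain ⟨j, hj⟩ := hi
        refine ⟨some j, ?_, by simp⟩
        rintro j' e
        obtain rfl := Option.some.inj e
        exact hj
      · exact ⟨none, by simp, fun _ => hi⟩
    choose k hk hk0 using this
    have hs1 := congrArg Prod.fst hsum
    have hs2 := congrArg Prod.snd hsum
    simp only [Prod.fst_sum, Prod.snd_sum, Prod.smul_fst, Prod.smul_snd, smul_eq_mul] at hs1 hs2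
    exact aj_sep_core hc h0 hn α β hh hin hout w (fun i => (z i).1) (fun i => (z i).2) k hw hw1 hs1 hs2 hk hk0
  obtain ⟨F, hF⟩ := geometric_hahn_banach_open_point (convex_convexHull ℝ S) hSo.convexHull hnot
  have hFS : ∀ z ∈ S, F z < F (0, h) := fun z hz => hF z (subset_convexHull ℝ S hz)
  have dec : ∀ x s, F (x, s) = F (x, 0) + s * F (0, 1) := by
    intro x s
    rw [← smul_eq_mul, ← map_smul, ← map_add]
    simp
  set γ := F (0, 1) with hγ
  have hγ0 : γ < 0 := by
    have := hFS (0, 3 * h) (Or.inr ⟨by simp, by simp, by show 2 * h < 3 * h; linarith⟩)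
    rw [dec 0 (3*h), dec 0 h] at this
    nlinarith
  have F00 : F ((0 : Fin 2 → ℝ), (0:ℝ)) = 0 := map_zero F
  refine ⟨(-γ⁻¹) • (F.toLinearMap.comp (LinearMap.inl ℝ (Fin 2 → ℝ) ℝ)), ?_, ?_⟩
  · intro x hx
    have hj : ∃ j, 20 < ℓ j x := by
      rcases hx with hx | hx
      · rcases lt_abs.1 hx with hx | hx
        · exact ⟨0, hx⟩
        · exact ⟨1, hx⟩
      · rcases lt_abs.1 hx with hx | hx
        · exact ⟨2, hx⟩
        · exact ⟨3, hx⟩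
    obtain ⟨j, hj⟩ := hj
    have key : ∀ s, g x < s → h ≤ s - -γ⁻¹ * F (x, 0) := by
      intro s hs
      have := hFS (x, s) (Or.inl (Set.mem_iUnion.2 ⟨j, hj, hs⟩))
      rw [dec x s, dec 0 h, F00] at this
      have h2 : γ * (s - -γ⁻¹ * F (x, 0)) = F (x,0) + s * γ := by
        have hi := mul_inv_cancel₀ hγ0.ne
        linear_combination F (x, 0) * hi
      nlinarith
    have : h + -γ⁻¹ * F (x, 0) ≤ g x := le_of_forall_gt_imp_ge_of_dense (fun s hs => by linarith [key s hs])
    simp only [LinearMap.smul_apply, LinearMap.comp_apply, LinearMap.inl_apply, smul_eq_mul]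
    have e : F.toLinearMap (x, 0) = F (x, 0) := rfl
    rw [e]
    linarith
  · intro x hx1 hx2
    have key : ∀ s, 2 * h < s → h ≤ s - -γ⁻¹ * F (x, 0) := by
      intro s hs
      have := hFS (x, s) (Or.inr ⟨hx1, hx2, hs⟩)
      rw [dec x s, dec 0 h, F00] at this
      have h2 : γ * (s - -γ⁻¹ * F (x, 0)) = F (x,0) + s * γ := by
        have hi := mul_inv_cancel₀ hγ0.ne
        linear_combination F (x, 0) * hi
      nlinarith
    have : h + -γ⁻¹ * F (x, 0) ≤ 2 * h := le_of_forall_gt_imp_ge_of_dense (fun s hs => by linarith [key s hs])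
    simp only [LinearMap.smul_apply, LinearMap.comp_apply, LinearMap.inl_apply, smul_eq_mul]
    have e : F.toLinearMap (x, 0) = F (x, 0) := rfl
    rw [e]
    linarith

theorem aj_box_compact {D a0 a1 b0 b1 : ℝ} (hdet : D * (a0 * b1 - a1 * b0) = 1) (ρ : ℝ) :
    IsCompact {x : Fin 2 → ℝ | |a0 * x 0 + a1 * x 1| ≤ ρ ∧ |b0 * x 0 + b1 * x 1| ≤ ρ} := by
  apply Metric.isCompact_of_isClosed_isBounded
  · apply IsClosed.and <;> exact isClosed_le (by fun_prop) (by fun_prop)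
  · apply (Metric.isBounded_closedBall (x := (0 : Fin 2 → ℝ))
      (r := |D| * (|b1| * ρ + |a1| * ρ) + |D| * (|b0| * ρ + |a0| * ρ))).subset
    rintro x ⟨h1, h2⟩
    have hρ : 0 ≤ ρ := (abs_nonneg _).trans h1
    rw [mem_closedBall_zero_iff, pi_norm_le_iff_of_nonneg (by positivity)]
    have e0 : x 0 = D * (b1 * (a0 * x 0 + a1 * x 1) + -a1 * (b0 * x 0 + b1 * x 1)) := by
      linear_combination (-x 0) * hdet
    have e1 : x 1 = D * (-b0 * (a0 * x 0 + a1 * x 1) + a0 * (b0 * x 0 + b1 * x 1)) := by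
      linear_combination (-x 1) * hdet
    have k : ∀ p q u v : ℝ, |u| ≤ ρ → |v| ≤ ρ → |D * (p * u + q * v)| ≤ |D| * (|p| * ρ + |q| * ρ) := by
      intro p q u v hu hv
      rw [abs_mul]
      apply mul_le_mul_of_nonneg_left _ (abs_nonneg _)
      refine (abs_add_le _ _).trans ?_
      rw [abs_mul, abs_mul]
      gcongr
    have k0 := k b1 (-a1) _ _ h1 h2
    have k1 := k (-b0) a0 _ _ h1 h2
    rw [← e0, abs_neg] at k0
    rw [← e1, abs_neg] at k1
    have p1 : 0 ≤ |D| * (|b1| * ρ + |a1| * ρ) := by positivity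
    have p2 : 0 ≤ |D| * (|b0| * ρ + |a0| * ρ) := by positivity
    intro i
    fin_cases i
    · simp only [Real.norm_eq_abs]; exact k0.trans (by linarith)
    · simp only [Real.norm_eq_abs]; exact k1.trans (by linarith)

theorem aj_box_vol {D a0 a1 b0 b1 : ℝ} (hD : 0 < D) (hdet : D * (a0 * b1 - a1 * b0) = 1) {ρ : ℝ}
    (hρ : 0 ≤ ρ) :
    MeasureTheory.volume {x : Fin 2 → ℝ | |a0 * x 0 + a1 * x 1| ≤ ρ ∧ |b0 * x 0 + b1 * x 1| ≤ ρ}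
      = ENNReal.ofReal (4 * ρ ^ 2 * D) := by
  set M : Matrix (Fin 2) (Fin 2) ℝ := !![a0, a1; b0, b1] with hM
  have hdetM : M.det = a0 * b1 - a1 * b0 := by rw [hM, Matrix.det_fin_two_of]
  have hL : LinearMap.det (Matrix.toLin' M) = D⁻¹ := by
    rw [LinearMap.det_toLin', hdetM]
    exact eq_inv_of_mul_eq_one_right hdet
  have hset : {x : Fin 2 → ℝ | |a0 * x 0 + a1 * x 1| ≤ ρ ∧ |b0 * x 0 + b1 * x 1| ≤ ρ}
      = (Matrix.toLin' M) ⁻¹' (Metric.closedBall 0 ρ) := by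
    ext x
    simp only [Set.mem_ofPred_eq, Set.mem_preimage, mem_closedBall_zero_iff]
    rw [pi_norm_le_iff_of_nonneg hρ, Fin.forall_fin_two]
    simp [hM, Matrix.toLin'_apply, Matrix.mulVec, dotProduct, Fin.sum_univ_two]
  rw [hset, MeasureTheory.Measure.addHaar_preimage_linearMap _ (by rw [hL]; positivity), hL,
    Real.volume_pi_closedBall _ hρ, inv_inv, abs_of_pos hD, ← ENNReal.ofReal_mul hD.le]
  congr 1
  simp
  ring

theorem aj_area {D a0 a1 b0 b1 : ℝ} (hD : 0 < D) (hdet : D * (a0 * b1 - a1 * b0) = 1) {ρ : ℝ}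
    (hρ : 0 ≤ ρ) {F : (Fin 2 → ℝ) → ℝ} (hF : MeasureTheory.Integrable F) {c : ℝ}
    (hle : ∀ x, |a0 * x 0 + a1 * x 1| ≤ ρ → |b0 * x 0 + b1 * x 1| ≤ ρ → F x ≤ c)
    (hz : ∀ x, ¬ (|a0 * x 0 + a1 * x 1| ≤ ρ ∧ |b0 * x 0 + b1 * x 1| ≤ ρ) → F x = 0) :
    ∫ x, F x ≤ c * (4 * ρ ^ 2 * D) := by
  set K := {x : Fin 2 → ℝ | |a0 * x 0 + a1 * x 1| ≤ ρ ∧ |b0 * x 0 + b1 * x 1| ≤ ρ} with hK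
  have hvol := aj_box_vol hD hdet hρ
  rw [← hK] at hvol
  have hKm : MeasurableSet K := (aj_box_compact hdet ρ).measurableSet
  rw [← MeasureTheory.setIntegral_eq_integral_of_forall_compl_eq_zero (s := K) hz]
  have hfin : MeasureTheory.volume K ≠ ⊤ := by rw [hvol]; exact ENNReal.ofReal_ne_top
  calc ∫ x in K, F x ≤ ∫ x in K, c := by
        apply MeasureTheory.setIntegral_mono_on hF.integrableOn _ hKm (fun x hx => hle x hx.1 hx.2)
        exact MeasureTheory.integrableOn_const hfin
    _ = c * (4 * ρ ^ 2 * D) := by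
        rw [MeasureTheory.setIntegral_const, smul_eq_mul, mul_comm, MeasureTheory.measureReal_def, hvol,
          ENNReal.toReal_ofReal (by positivity)]

theorem aj_cmul {f : (Fin 2 → ℝ) → ℝ} (c : ℝ) (hf : Differentiable ℝ f)
    (i : Fin 2) (x : Fin 2 → ℝ) : pd i (fun y => c * f y) x = c * pd i f x := by
  rw [aj_mul (by fun_prop) hf, aj_const]; ring

theorem aj_form (a0 a1 : ℝ) (i : Fin 2) (x : Fin 2 → ℝ) :
    pd i (fun y => a0 * y 0 + a1 * y 1) x = ![a0, a1] i := by
  rw [aj_add (by fun_prop) (by fun_prop), aj_cmul _ (by fun_prop), aj_cmul _ (by fun_prop),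
    aj_coord, aj_coord]
  fin_cases i <;> simp

theorem aj_prodd {k l : ℝ → ℝ} (hk : ContDiff ℝ (⊤ : ℕ∞) k) (hl : ContDiff ℝ (⊤ : ℕ∞) l)
    (a0 a1 b0 b1 : ℝ) (i : Fin 2) (x : Fin 2 → ℝ) :
    pd i (fun y => k (a0 * y 0 + a1 * y 1) * l (b0 * y 0 + b1 * y 1)) x =
      ![a0, a1] i * (deriv k (a0 * x 0 + a1 * x 1) * l (b0 * x 0 + b1 * x 1)) +
      ![b0, b1] i * (k (a0 * x 0 + a1 * x 1) * deriv l (b0 * x 0 + b1 * x 1)) := by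
  have dk : Differentiable ℝ k := hk.differentiable (by simp)
  have dl : Differentiable ℝ l := hl.differentiable (by simp)
  rw [aj_mul (f := fun y => k (a0 * y 0 + a1 * y 1)) (g := fun y => l (b0 * y 0 + b1 * y 1))
    (dk.comp (by fun_prop)) (dl.comp (by fun_prop)),
    aj_comp (k := k) (k' := deriv k) (f := fun y => a0 * y 0 + a1 * y 1) (by fun_prop) i x (dk _).hasDerivAt,
    aj_comp (k := l) (k' := deriv l) (f := fun y => b0 * y 0 + b1 * y 1) (by fun_prop) i x (dl _).hasDerivAt,
    aj_form, aj_form]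
  ring

theorem aj_prodsm {k l : ℝ → ℝ} (hk : ContDiff ℝ (⊤ : ℕ∞) k) (hl : ContDiff ℝ (⊤ : ℕ∞) l)
    (a0 a1 b0 b1 : ℝ) : ContDiff ℝ (⊤ : ℕ∞)
      (fun y : Fin 2 → ℝ => k (a0 * y 0 + a1 * y 1) * l (b0 * y 0 + b1 * y 1)) := by
  fun_prop

theorem aj_derivsm {k : ℝ → ℝ} (hk : ContDiff ℝ (⊤ : ℕ∞) k) : ContDiff ℝ (⊤ : ℕ∞) (deriv k) := by
  have : ContDiff ℝ ((⊤ : ℕ∞) + 1 : WithTop ℕ∞) k := by simpa using hk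
  exact (contDiff_succ_iff_deriv.1 this).2.2

theorem aj_prodd2 {k l : ℝ → ℝ} (hk : ContDiff ℝ (⊤ : ℕ∞) k) (hl : ContDiff ℝ (⊤ : ℕ∞) l)
    (a0 a1 b0 b1 : ℝ) (i j : Fin 2) (x : Fin 2 → ℝ) :
    pd i (pd j (fun y => k (a0 * y 0 + a1 * y 1) * l (b0 * y 0 + b1 * y 1))) x =
      ![a0, a1] i * ![a0, a1] j * (deriv (deriv k) (a0 * x 0 + a1 * x 1) * l (b0 * x 0 + b1 * x 1)) +
      (![a0, a1] i * ![b0, b1] j + ![b0, b1] i * ![a0, a1] j) *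
        (deriv k (a0 * x 0 + a1 * x 1) * deriv l (b0 * x 0 + b1 * x 1)) +
      ![b0, b1] i * ![b0, b1] j * (k (a0 * x 0 + a1 * x 1) * deriv (deriv l) (b0 * x 0 + b1 * x 1)) := by
  have e : pd j (fun y => k (a0 * y 0 + a1 * y 1) * l (b0 * y 0 + b1 * y 1)) = fun x =>
      ![a0, a1] j * (deriv k (a0 * x 0 + a1 * x 1) * l (b0 * x 0 + b1 * x 1)) +
      ![b0, b1] j * (k (a0 * x 0 + a1 * x 1) * deriv l (b0 * x 0 + b1 * x 1)) :=
    funext fun x => aj_prodd hk hl a0 a1 b0 b1 j x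
  have s1 := ajI_diff (aj_prodsm (aj_derivsm hk) hl a0 a1 b0 b1)
  have s2 := ajI_diff (aj_prodsm hk (aj_derivsm hl) a0 a1 b0 b1)
  rw [e, aj_add (s1.const_mul _) (s2.const_mul _), aj_cmul _ s1, aj_cmul _ s2,
    aj_prodd (aj_derivsm hk) hl, aj_prodd hk (aj_derivsm hl)]
  ring

theorem aj_bump : ∃ (χ Ψ : ℝ → ℝ) (K : ℝ), ContDiff ℝ (⊤ : ℕ∞) χ ∧ ContDiff ℝ (⊤ : ℕ∞) Ψ ∧
    (∀ s, 0 ≤ χ s ∧ χ s ≤ 1) ∧ (∀ s, |s| ≤ 1/8 → χ s = 1) ∧ (∀ s, 1/2 < |s| → χ s = 0) ∧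
    (∀ s, 1/2 < |s| → Ψ s = 0) ∧ (∀ s, 1/2 < |s| → deriv (deriv Ψ) s = 0) ∧
    (∀ s, (deriv χ s)^2 ≤ Ψ s) ∧ (∀ s, (χ s)^2 ≤ Ψ s) ∧ (∀ s, |Ψ s| ≤ K) ∧
    (∀ s, |deriv (deriv Ψ) s| ≤ K) := by
  let f : ContDiffBump (0:ℝ) := ⟨1/8, 1/4, by norm_num, by norm_num⟩
  let g : ContDiffBump (0:ℝ) := ⟨1/4, 1/2, by norm_num, by norm_num⟩
  have fs : ContDiff ℝ (⊤ : ℕ∞) f := f.contDiff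
  have gs : ContDiff ℝ (⊤ : ℕ∞) g := g.contDiff
  obtain ⟨M0, hM0⟩ := (aj_derivsm fs).continuous.bounded_above_of_compact_support f.hasCompactSupport.deriv
  set M := max 1 (M0 ^ 2) with hM
  have hM1 : 1 ≤ M := le_max_left _ _
  have Ps : ContDiff ℝ (⊤ : ℕ∞) (fun s => M * g s) := contDiff_const.mul gs
  have Pc : HasCompactSupport (fun s => M * g s) := g.hasCompactSupport.mul_left
  obtain ⟨K1, hK1⟩ := Ps.continuous.bounded_above_of_compact_support Pc
  obtain ⟨K2, hK2⟩ := (aj_derivsm (aj_derivsm Ps)).continuous.bounded_above_of_compact_support Pc.deriv.deriv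
  have g1 : ∀ s : ℝ, |s| ≤ 1/4 → g s = 1 := fun s hs =>
    g.one_of_mem_closedBall (by simpa [Metric.mem_closedBall, Real.dist_eq, g] using hs)
  have g0 : ∀ s : ℝ, 1/2 < |s| → M * g s = 0 := fun s hs => by
    rw [g.zero_of_le_dist (by simpa [Real.dist_eq, g] using hs.le), mul_zero]
  have f0 : ∀ s : ℝ, 1/4 < |s| → f s = 0 := fun s hs => 
    f.zero_of_le_dist (by simpa [Real.dist_eq, f] using hs.le)
  refine ⟨f, fun s => M * g s, max K1 K2, fs, Ps, fun s => ⟨f.nonneg, f.le_one⟩, ?_, ?_, g0, ?_, ?_, ?_, ?_, ?_⟩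
  · exact fun s hs => f.one_of_mem_closedBall (by simpa [Metric.mem_closedBall, Real.dist_eq, f] using hs)
  · exact fun s hs => f0 s (by linarith)
  · intro s hs
    have h1 : (fun s => M * g s) =ᶠ[𝓝 s] fun _ => 0 := by
      filter_upwards [(isOpen_lt continuous_const continuous_abs).mem_nhds hs] with t ht
      exact g0 t ht
    rw [h1.deriv.deriv_eq]
    simp
  · intro s
    rcases le_or_gt |s| (1/4) with hs | hs
    · show deriv f s ^ 2 ≤ M * g s
      rw [g1 s hs, mul_one]
      refine le_trans ?_ (le_max_right _ _)
      have := hM0 s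
      rw [Real.norm_eq_abs] at this
      exact sq_le_sq' (by linarith [neg_abs_le (deriv f s)]) ((le_abs_self _).trans this)
    · have h1 : f =ᶠ[𝓝 s] fun _ => (0:ℝ) := by
        filter_upwards [(isOpen_lt continuous_const continuous_abs).mem_nhds hs] with t ht
        exact f0 t ht
      rw [h1.deriv_eq]
      have h2 := g.nonneg (x := s)
      show deriv (fun _ => (0:ℝ)) s ^ 2 ≤ M * g s
      rw [deriv_const, zero_pow two_ne_zero]
      positivity
  · intro s
    rcases le_or_gt |s| (1/4) with hs | hs
    · show f s ^ 2 ≤ M * g s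
      rw [g1 s hs, mul_one]
      have := f.nonneg (x := s); have := f.le_one (x := s)
      nlinarith
    · have h2 := g.nonneg (x := s)
      show f s ^ 2 ≤ M * g s
      rw [f0 s hs, zero_pow two_ne_zero]
      positivity
  · exact fun s => (hK1 s).trans (le_max_left _ _)
  · exact fun s => (hK2 s).trans (le_max_right _ _)

theorem aj_ibp {φ g : (Fin 2 → ℝ) → ℝ} (hφ : ContDiff ℝ 2 φ) (hφc : HasCompactSupport φ)
    (hg : ContDiff ℝ 2 g) (c0 c1 c2 : ℝ) :
    ∫ x, (φ x * (c0 * pd 0 (pd 0 g) x + 2 * c1 * pd 0 (pd 1 g) x + c2 * pd 1 (pd 1 g) x) -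
      g x * (c0 * pd 0 (pd 0 φ) x + 2 * c1 * pd 0 (pd 1 φ) x + c2 * pd 1 (pd 1 φ) x)) = 0 := by
  have p0 := aj_sm2 hφ 0
  have p1 := aj_sm2 hφ 1
  have g0 := aj_sm2 hg 0
  have g1 := aj_sm2 hg 1
  have hφ1 : ContDiff ℝ 1 φ := hφ.of_le (by norm_num)
  have hg1 : ContDiff ℝ 1 g := hg.of_le (by norm_num)
  have dφ := hφ1.differentiable one_ne_zero
  have dg := hg1.differentiable one_ne_zero
  have dp0 := p0.differentiable one_ne_zero
  have dp1 := p1.differentiable one_ne_zero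
  have dg0 := g0.differentiable one_ne_zero
  have dg1 := g1.differentiable one_ne_zero
  have z : ∀ x, x ∉ tsupport φ → φ x = 0 ∧ pd 0 φ x = 0 ∧ pd 1 φ x = 0 := by
    intro x hx
    have hf : fderiv ℝ φ x = 0 :=
      image_eq_zero_of_notMem_tsupport (fun h => hx (tsupport_fderiv_subset ℝ h))
    exact ⟨image_eq_zero_of_notMem_tsupport hx, by simp [pd, hf], by simp [pd, hf]⟩
  have key := aj_div (f := fun x => c0 * (φ x * pd 0 g x - g x * pd 0 φ x) + c1 * (φ x * pd 1 g x - g x * pd 1 φ x))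
    (g := fun x => c1 * (φ x * pd 0 g x - g x * pd 0 φ x) + c2 * (φ x * pd 1 g x - g x * pd 1 φ x))
    (by fun_prop) (HasCompactSupport.intro hφc (fun x hx => by
      obtain ⟨h1, h2, h3⟩ := z x hx; simp [h1, h2, h3]))
    (by fun_prop) (HasCompactSupport.intro hφc (fun x hx => by
      obtain ⟨h1, h2, h3⟩ := z x hx; simp [h1, h2, h3]))
  rw [← key]
  congr 1
  ext x
  have D0 : Differentiable ℝ (fun x => φ x * pd 0 g x - g x * pd 0 φ x) := by fun_prop
  have D1 : Differentiable ℝ (fun x => φ x * pd 1 g x - g x * pd 1 φ x) := by fun_prop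
  have e0 : ∀ i, pd i (fun x => φ x * pd 0 g x - g x * pd 0 φ x) x =
      (pd i φ x * pd 0 g x + φ x * pd i (pd 0 g) x) - (pd i g x * pd 0 φ x + g x * pd i (pd 0 φ) x) := by
    intro i; rw [aj_sub (dφ.fun_mul dg0) (dg.fun_mul dp0), aj_mul dφ dg0, aj_mul dg dp0]
  have e1 : ∀ i, pd i (fun x => φ x * pd 1 g x - g x * pd 1 φ x) x =
      (pd i φ x * pd 1 g x + φ x * pd i (pd 1 g) x) - (pd i g x * pd 1 φ x + g x * pd i (pd 1 φ) x) := by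
    intro i; rw [aj_sub (dφ.fun_mul dg1) (dg.fun_mul dp1), aj_mul dφ dg1, aj_mul dg dp1]
  rw [aj_add (D0.const_mul _) (D1.const_mul _), aj_add (D0.const_mul _) (D1.const_mul _),
    aj_cmul _ D0, aj_cmul _ D1, aj_cmul _ D0, aj_cmul _ D1, e0, e0, e1, e1, aj_comm hg, aj_comm hφ]
  ring

theorem aj_E1 : ∃ C : ℝ, ∀ (g : (Fin 2 → ℝ) → ℝ) (R h D a0 a1 b0 b1 : ℝ), ContDiff ℝ (⊤ : ℕ∞) g →
    (∀ x, 0 < pd 0 (pd 0 g) x) →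
    (∀ x, 0 < pd 0 (pd 0 g) x * pd 1 (pd 1 g) x - pd 0 (pd 1 g) x ^ 2) →
    (∀ x, 0 ≤ g x) → 0 < D → D * (a0 * b1 - a1 * b0) = 1 →
    (∀ x : Fin 2 → ℝ, |a0 * x 0 + a1 * x 1| + |b0 * x 0 + b1 * x 1| ≤ 1 → g x + g (-x) ≤ h) →
    (∀ x : Fin 2 → ℝ, ‖x‖ ≤ R → |a0 * x 0 + a1 * x 1| ≤ 1/8 ∧ |b0 * x 0 + b1 * x 1| ≤ 1/8) → h ≤ D →
    ajCut (fun _ => 1) (pd 0 (pd 0 g)) (pd 0 (pd 1 g)) (pd 1 (pd 1 g)) C R := by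
  obtain ⟨χ, Ψ, K, hχ, hΨ, χ01, χ1, χ0, Ψ0, hzPsi, χΨ1, χΨ, ΨK, hbPsi⟩ := aj_bump
  refine ⟨4 * K ^ 2, ?_⟩
  intro g R h D a0 a1 b0 b1 hg ha0 hS hn hD hdet hout hR hhD
  have hη := aj_prodsm hχ hχ a0 a1 b0 b1
  have hθ := aj_prodsm hΨ hΨ a0 a1 b0 b1
  have hηc : HasCompactSupport (fun y : Fin 2 → ℝ => χ (a0 * y 0 + a1 * y 1) * χ (b0 * y 0 + b1 * y 1)) := by
    apply HasCompactSupport.intro (aj_box_compact hdet (1/2))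
    intro x hx
    by_contra hne
    apply hx
    refine ⟨?_, ?_⟩ <;> by_contra hcon <;> push Not at hcon <;> simp [χ0 _ hcon] at hne
  have hθc : HasCompactSupport (fun y : Fin 2 → ℝ => Ψ (a0 * y 0 + a1 * y 1) * Ψ (b0 * y 0 + b1 * y 1)) := by
    apply HasCompactSupport.intro (aj_box_compact hdet (1/2))
    intro x hx
    by_contra hne
    apply hx
    refine ⟨?_, ?_⟩ <;> by_contra hcon <;> push Not at hcon <;> simp [Ψ0 _ hcon] at hne
  have c00 := (aj_smI (aj_smI hg 0) 0).continuous
  have c01 := (aj_smI (aj_smI hg 1) 0).continuous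
  have c11 := (aj_smI (aj_smI hg 1) 1).continuous
  refine ⟨_, ajI_1 hη, hηc, ?_, ?_, ?_⟩
  · intro x
    obtain ⟨u1, u2⟩ := χ01 (a0 * x 0 + a1 * x 1)
    obtain ⟨v1, v2⟩ := χ01 (b0 * x 0 + b1 * x 1)
    exact ⟨mul_nonneg u1 v1, mul_le_one₀ u2 v1 v2⟩
  · intro x hx
    obtain ⟨h1, h2⟩ := hR x hx
    simp only [χ1 _ h1, χ1 _ h2, mul_one]
  set θ : (Fin 2 → ℝ) → ℝ := fun y => Ψ (a0 * y 0 + a1 * y 1) * Ψ (b0 * y 0 + b1 * y 1) with hθdef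
  set c0 := a1 ^ 2 + b1 ^ 2 with hc0
  set c1 := -(a0 * a1 + b0 * b1) with hc1
  set c2 := a0 ^ 2 + b0 ^ 2 with hc2
  have ibp := aj_ibp (ajI_2 hθ) hθc (ajI_2 hg) c0 c1 c2
  have t00 := (aj_smI (aj_smI hθ 0) 0).continuous
  have t01 := (aj_smI (aj_smI hθ 1) 0).continuous
  have t11 := (aj_smI (aj_smI hθ 1) 1).continuous
  have cθ := hθ.continuous
  have cg := hg.continuous
  have I1 : MeasureTheory.Integrable (fun x => θ x * (c0 * pd 0 (pd 0 g) x + 2 * c1 * pd 0 (pd 1 g) x + c2 * pd 1 (pd 1 g) x)) := by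
    apply Continuous.integrable_of_hasCompactSupport (by fun_prop)
    exact hθc.mul_right
  have I2 : MeasureTheory.Integrable (fun x => g x * (c0 * pd 0 (pd 0 θ) x + 2 * c1 * pd 0 (pd 1 θ) x + c2 * pd 1 (pd 1 θ) x)) := by
    apply Continuous.integrable_of_hasCompactSupport (by fun_prop)
    apply HasCompactSupport.mul_left
    exact (((aj_supp (aj_supp hθc 0) 0).mul_left).add ((aj_supp (aj_supp hθc 1) 0).mul_left)).add
      ((aj_supp (aj_supp hθc 1) 1).mul_left)
  rw [MeasureTheory.integral_sub I1 I2, sub_eq_zero] at ibp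
  have hdet' : (a0 * b1 - a1 * b0) ^ 2 = (D ^ 2)⁻¹ := by
    have : a0 * b1 - a1 * b0 = D⁻¹ := eq_inv_of_mul_eq_one_right hdet
    rw [this, inv_pow]
  have op : ∀ x : Fin 2 → ℝ, c0 * pd 0 (pd 0 θ) x + 2 * c1 * pd 0 (pd 1 θ) x + c2 * pd 1 (pd 1 θ) x =
      (D ^ 2)⁻¹ * (deriv (deriv Ψ) (a0 * x 0 + a1 * x 1) * Ψ (b0 * x 0 + b1 * x 1) +
        Ψ (a0 * x 0 + a1 * x 1) * deriv (deriv Ψ) (b0 * x 0 + b1 * x 1)) := by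
    intro x
    rw [hθdef, aj_prodd2 hΨ hΨ, aj_prodd2 hΨ hΨ, aj_prodd2 hΨ hΨ, ← hdet', hc0, hc1, hc2]
    simp only [Matrix.cons_val_zero, Matrix.cons_val_one]
    ring
  have hΨn : ∀ s, 0 ≤ Ψ s := fun s => (sq_nonneg _).trans (χΨ s)
  calc ∫ x, ajQ (fun _ => 1) (pd 0 (pd 0 g)) (pd 0 (pd 1 g)) (pd 1 (pd 1 g)) _ x
      ≤ ∫ x, 2 * (θ x * (c0 * pd 0 (pd 0 g) x + 2 * c1 * pd 0 (pd 1 g) x + c2 * pd 1 (pd 1 g) x)) := by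
        apply MeasureTheory.integral_mono (ajQ_int continuous_const c00 c01 c11 (ajI_1 hη) hηc) (I1.const_mul 2)
        intro x
        unfold ajQ
        simp only [aj_prodd hχ hχ, one_mul, Matrix.cons_val_zero, Matrix.cons_val_one]
        set A := pd 0 (pd 0 g) x
        set B := pd 0 (pd 1 g) x
        set E := pd 1 (pd 1 g) x
        set α := a0 * x 0 + a1 * x 1
        set β := b0 * x 0 + b1 * x 1
        have q := fun ξ ζ => aj_qpos (ξ := ξ) (ζ := ζ) (ha0 x) (hS x)
        have q1 := q a0 a1
        have q2 := q b0 b1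
        have q3 := q (a0 * (deriv χ α * χ β) - b0 * (χ α * deriv χ β)) (a1 * (deriv χ α * χ β) - b1 * (χ α * deriv χ β))
        have m1 : (deriv χ α) ^ 2 * (χ β) ^ 2 ≤ Ψ α * Ψ β := mul_le_mul (χΨ1 _) (χΨ _) (sq_nonneg _) (hΨn _)
        have m2 : (χ α) ^ 2 * (deriv χ β) ^ 2 ≤ Ψ α * Ψ β := mul_le_mul (χΨ _) (χΨ1 _) (sq_nonneg _) (hΨn _)
        have r1 := mul_le_mul_of_nonneg_right m1 q1
        have r2 := mul_le_mul_of_nonneg_right m2 q2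
        have eθ : θ x = Ψ α * Ψ β := rfl
        rw [eθ, hc0, hc1, hc2]
        show E * _ ^ 2 - 2 * B * _ * _ + A * _ ^ 2 ≤ _
        nlinarith [q3, r1, r2]
    _ = ∫ x, 2 * (g x * (c0 * pd 0 (pd 0 θ) x + 2 * c1 * pd 0 (pd 1 θ) x + c2 * pd 1 (pd 1 θ) x)) := by
        rw [MeasureTheory.integral_const_mul, MeasureTheory.integral_const_mul, ibp]
    _ ≤ (4 * K ^ 2 * h * (D ^ 2)⁻¹) * (4 * (1/2) ^ 2 * D) := by
        apply aj_area hD hdet (by norm_num) (I2.const_mul 2)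
        · intro x h1 h2
          rw [op x]
          have g1 := hout x (by linarith)
          have g2 := hn (-x)
          have g3 := hn x
          have gh : g x ≤ h := by linarith
          set α := a0 * x 0 + a1 * x 1
          set β := b0 * x 0 + b1 * x 1
          have hK : 0 ≤ K := (abs_nonneg _).trans (ΨK 0)
          have b : ∀ u v : ℝ, |u| ≤ K → |v| ≤ K → u * v ≤ K ^ 2 := by
            intro u v hu hv
            refine (le_abs_self _).trans ?_
            rw [abs_mul, sq]
            exact mul_le_mul hu hv (abs_nonneg _) hK
          have b1 := b _ _ (hbPsi α) (ΨK β)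
          have b2 := b _ _ (ΨK α) (hbPsi β)
          have s : g x * (deriv (deriv Ψ) α * Ψ β + Ψ α * deriv (deriv Ψ) β) ≤ h * (2 * K ^ 2) :=
            (mul_le_mul_of_nonneg_left (by linarith) g3).trans (mul_le_mul_of_nonneg_right gh (by positivity))
          have s2 := mul_le_mul_of_nonneg_left s (show 0 ≤ (D ^ 2)⁻¹ by positivity)
          linarith
        · intro x hx
          rw [op x]
          rw [not_and_or, not_le, not_le] at hx
          rcases hx with hx | hx <;> simp [Ψ0 _ hx, hzPsi _ hx]
    _ ≤ 4 * K ^ 2 := by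
        have : (4 * K ^ 2 * h * (D ^ 2)⁻¹) * (4 * (1/2) ^ 2 * D) = 4 * K ^ 2 * (h / D) := by
          field_simp; ring
        rw [this]
        apply mul_le_of_le_one_right (by positivity)
        rwa [div_le_one hD]

theorem aj_maxpow (n : ℕ) (t : ℝ) :
    HasDerivAt (fun t : ℝ => max 0 t ^ (n + 2)) ((n + 2 : ℕ) * max 0 t ^ (n + 1)) t := by
  have hne : ∀ t : ℝ, t ≠ 0 → HasDerivAt (fun t : ℝ => max 0 t ^ (n + 2)) ((n + 2 : ℕ) * max 0 t ^ (n + 1)) t := by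
    intro t ht
    rcases lt_or_gt_of_ne ht with ht | ht
    · have h1 : (fun t : ℝ => max 0 t ^ (n + 2)) =ᶠ[𝓝 t] fun _ => 0 := by
        filter_upwards [Iio_mem_nhds ht] with s hs
        have hs : s < 0 := hs
        rw [max_eq_left hs.le, zero_pow (by omega)]
      rw [max_eq_left ht.le, zero_pow (by omega), mul_zero]
      exact (hasDerivAt_const t (0:ℝ)).congr_of_eventuallyEq h1
    · have h1 : (fun t : ℝ => max 0 t ^ (n + 2)) =ᶠ[𝓝 t] fun t => t ^ (n + 2) := by
        filter_upwards [Ioi_mem_nhds ht] with s hs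
        have hs : 0 < s := hs
        rw [max_eq_right hs.le]
      rw [max_eq_right ht.le]
      exact (hasDerivAt_pow (n + 2) t).congr_of_eventuallyEq h1
  rcases eq_or_ne t 0 with rfl | ht
  · exact hasDerivAt_of_hasDerivAt_of_ne (g := fun t : ℝ => (n + 2 : ℕ) * max 0 t ^ (n + 1))
      (fun y hy => hne y hy) (Continuous.continuousAt (by fun_prop)) (Continuous.continuousAt (by fun_prop))
  · exact hne t ht

theorem aj_hd3 (t : ℝ) : HasDerivAt (fun t : ℝ => max 0 t ^ 3) (3 * max 0 t ^ 2) t := by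
  have h := aj_maxpow 1 t
  have e : ((1 + 2 : ℕ) : ℝ) * max 0 t ^ (1 + 1) = 3 * max 0 t ^ 2 := by norm_num
  rw [e] at h
  exact h

theorem aj_hd2 (t : ℝ) : HasDerivAt (fun t : ℝ => 3 * max 0 t ^ 2) (6 * max 0 t) t := by
  have h := (aj_maxpow 0 t).const_mul 3
  have e : 3 * (((0 + 2 : ℕ) : ℝ) * max 0 t ^ (0 + 1)) = 6 * max 0 t := by norm_num; ring
  rw [e] at h
  exact h

theorem aj_max2 : ContDiff ℝ 1 (fun t : ℝ => 3 * max 0 t ^ 2) := by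
  rw [contDiff_one_iff_deriv]
  have h : ∀ t : ℝ, HasDerivAt (fun t : ℝ => 3 * max 0 t ^ 2) (6 * max 0 t) t := aj_hd2
  refine ⟨fun t => (h t).differentiableAt, ?_⟩
  rw [show deriv (fun t : ℝ => 3 * max 0 t ^ 2) = fun t => 6 * max 0 t from funext fun t => (h t).deriv]
  fun_prop

theorem aj_max3 : ContDiff ℝ 2 (fun t : ℝ => max 0 t ^ 3) := by
  have h : ∀ t : ℝ, HasDerivAt (fun t : ℝ => max 0 t ^ 3) (3 * max 0 t ^ 2) t := aj_hd3
  have : ContDiff ℝ (1 + 1) (fun t : ℝ => max 0 t ^ 3) := by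
    rw [contDiff_succ_iff_deriv]
    refine ⟨fun t => (h t).differentiableAt, by simp, ?_⟩
    rw [show deriv (fun t : ℝ => max 0 t ^ 3) = fun t => 3 * max 0 t ^ 2 from funext fun t => (h t).deriv]
    exact aj_max2
  rwa [one_add_one_eq_two] at this

theorem aj_kappa : ∃ (k : ℝ → ℝ) (K : ℝ), 0 ≤ K ∧ ContDiff ℝ (⊤ : ℕ∞) k ∧ (∀ s, 0 ≤ k s ∧ k s ≤ 1) ∧
    (∀ s, 1/2 ≤ s → k s = 1) ∧ (∀ s, s ≤ 0 → k s = 0) ∧ (∀ s, (deriv k s) ^ 2 ≤ K * max 0 s) := by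
  set k : ℝ → ℝ := fun s => Real.smoothTransition (4 * s - 1) with hk
  have ks : ContDiff ℝ (⊤ : ℕ∞) k := Real.smoothTransition.contDiff.comp (by fun_prop)
  have k1 : ∀ s, 1/2 ≤ s → k s = 1 := fun s hs => Real.smoothTransition.one_of_one_le (by linarith)
  have k0 : ∀ s, s ≤ 1/4 → k s = 0 := fun s hs => Real.smoothTransition.zero_of_nonpos (by linarith)
  have d0 : ∀ s, s < 1/4 → deriv k s = 0 := by
    intro s hs
    have h1 : k =ᶠ[𝓝 s] fun _ => (0:ℝ) := by
      filter_upwards [Iio_mem_nhds hs] with t ht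
      exact k0 t (le_of_lt ht)
    rw [h1.deriv_eq]; simp
  have d1 : ∀ s, 1/2 < s → deriv k s = 0 := by
    intro s hs
    have h1 : k =ᶠ[𝓝 s] fun _ => (1:ℝ) := by
      filter_upwards [Ioi_mem_nhds hs] with t ht
      exact k1 t (le_of_lt ht)
    rw [h1.deriv_eq]; simp
  have dc : HasCompactSupport (deriv k) := by
    apply HasCompactSupport.intro (isCompact_Icc (a := (1/4:ℝ)) (b := 1/2))
    intro s hs
    rw [Set.mem_Icc, not_and_or, not_le, not_le] at hs
    rcases hs with hs | hs
    · exact d0 s hs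
    · exact d1 s hs
  obtain ⟨M, hM⟩ := (aj_derivsm ks).continuous.bounded_above_of_compact_support dc
  refine ⟨k, 4 * M ^ 2, by positivity, ks, fun s => ⟨Real.smoothTransition.nonneg _, Real.smoothTransition.le_one _⟩, k1,
    fun s hs => k0 s (by linarith), ?_⟩
  intro s
  rcases lt_or_ge s (1/4) with hs | hs
  · rw [d0 s hs, zero_pow two_ne_zero]; positivity
  · rw [max_eq_right (by linarith)]
    have h1 := hM s
    rw [Real.norm_eq_abs] at h1
    have h2 : deriv k s ^ 2 ≤ M ^ 2 := sq_le_sq' (by linarith [neg_abs_le (deriv k s)]) ((le_abs_self _).trans h1)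
    nlinarith [sq_nonneg M]

theorem aj_ibpw {a b d w φ : (Fin 2 → ℝ) → ℝ} (ha : ContDiff ℝ (⊤ : ℕ∞) a)
    (hb : ContDiff ℝ (⊤ : ℕ∞) b) (hd : ContDiff ℝ (⊤ : ℕ∞) d) (hw : ContDiff ℝ (⊤ : ℕ∞) w)
    (hab : ∀ x, pd 1 a x = pd 0 b x) (hbd : ∀ x, pd 1 b x = pd 0 d x)
    (hpde : ∀ x, d x * pd 0 (pd 0 w) x - 2 * b x * pd 0 (pd 1 w) x + a x * pd 1 (pd 1 w) x = 0)
    (hφ : ContDiff ℝ 2 φ) (hφc : HasCompactSupport φ) :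
    ∫ x, w x * (d x * pd 0 (pd 0 φ) x - 2 * b x * pd 0 (pd 1 φ) x + a x * pd 1 (pd 1 φ) x) = 0 := by
  have p0 := aj_sm2 hφ 0
  have p1 := aj_sm2 hφ 1
  have w0 := ajI_1 (aj_smI hw 0)
  have w1 := ajI_1 (aj_smI hw 1)
  have hφ1 : ContDiff ℝ 1 φ := hφ.of_le (by norm_num)
  have ha1 := ajI_1 ha
  have hb1 := ajI_1 hb
  have hd1 := ajI_1 hd
  have hw1 := ajI_1 hw
  have dφ := hφ1.differentiable one_ne_zero
  have da := ha1.differentiable one_ne_zero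
  have db := hb1.differentiable one_ne_zero
  have dd := hd1.differentiable one_ne_zero
  have dw := hw1.differentiable one_ne_zero
  have dp0 := p0.differentiable one_ne_zero
  have dp1 := p1.differentiable one_ne_zero
  have dw0 := w0.differentiable one_ne_zero
  have dw1 := w1.differentiable one_ne_zero
  have z : ∀ x, x ∉ tsupport φ → φ x = 0 ∧ pd 0 φ x = 0 ∧ pd 1 φ x = 0 := by
    intro x hx
    have hf : fderiv ℝ φ x = 0 :=
      image_eq_zero_of_notMem_tsupport (fun h => hx (tsupport_fderiv_subset ℝ h))
    exact ⟨image_eq_zero_of_notMem_tsupport hx, by simp [pd, hf], by simp [pd, hf]⟩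
  have key := aj_div
    (f := fun x => w x * (d x * pd 0 φ x - b x * pd 1 φ x) - φ x * (d x * pd 0 w x - b x * pd 1 w x))
    (g := fun x => w x * (a x * pd 1 φ x - b x * pd 0 φ x) - φ x * (a x * pd 1 w x - b x * pd 0 w x))
    (by fun_prop) (HasCompactSupport.intro hφc (fun x hx => by
      obtain ⟨h1, h2, h3⟩ := z x hx; simp [h1, h2, h3]))
    (by fun_prop) (HasCompactSupport.intro hφc (fun x hx => by
      obtain ⟨h1, h2, h3⟩ := z x hx; simp [h1, h2, h3]))
  rw [← key]
  congr 1
  ext x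
  rw [aj_sub (dw.fun_mul ((dd.fun_mul dp0).fun_sub (db.fun_mul dp1))) (dφ.fun_mul ((dd.fun_mul dw0).fun_sub (db.fun_mul dw1))),
    aj_sub (dw.fun_mul ((da.fun_mul dp1).fun_sub (db.fun_mul dp0))) (dφ.fun_mul ((da.fun_mul dw1).fun_sub (db.fun_mul dw0))),
    aj_mul dw ((dd.fun_mul dp0).fun_sub (db.fun_mul dp1)), aj_mul dφ ((dd.fun_mul dw0).fun_sub (db.fun_mul dw1)),
    aj_mul dw ((da.fun_mul dp1).fun_sub (db.fun_mul dp0)), aj_mul dφ ((da.fun_mul dw1).fun_sub (db.fun_mul dw0)),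
    aj_sub (dd.fun_mul dp0) (db.fun_mul dp1), aj_sub (dd.fun_mul dw0) (db.fun_mul dw1),
    aj_sub (da.fun_mul dp1) (db.fun_mul dp0), aj_sub (da.fun_mul dw1) (db.fun_mul dw0),
    aj_mul dd dp0, aj_mul db dp1, aj_mul dd dw0, aj_mul db dw1, aj_mul da dp1, aj_mul db dp0,
    aj_mul da dw1, aj_mul db dw0, aj_comm hφ, aj_comm (ajI_2 hw), hab, hbd]
  linear_combination φ x * hpde x

theorem aj_E0 : ∃ C : ℝ, ∀ (g w : (Fin 2 → ℝ) → ℝ) (R h D a0 a1 b0 b1 p0 p1 : ℝ),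
    ContDiff ℝ (⊤ : ℕ∞) g → ContDiff ℝ (⊤ : ℕ∞) w →
    (∀ x, 0 < pd 0 (pd 0 g) x) →
    (∀ x, 0 < pd 0 (pd 0 g) x * pd 1 (pd 1 g) x - pd 0 (pd 1 g) x ^ 2) →
    (∀ x, 0 < w x) → (∀ x, w x * (pd 0 (pd 0 g) x * pd 1 (pd 1 g) x - pd 0 (pd 1 g) x ^ 2) = 1) →
    (∀ x, pd 1 (pd 1 g) x * pd 0 (pd 0 w) x - 2 * pd 0 (pd 1 g) x * pd 0 (pd 1 w) x +
      pd 0 (pd 0 g) x * pd 1 (pd 1 w) x = 0) →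
    0 < h → 0 < D → D * (a0 * b1 - a1 * b0) = 1 →
    (∀ x : Fin 2 → ℝ, 20 < |a0 * x 0 + a1 * x 1| ∨ 20 < |b0 * x 0 + b1 * x 1| →
      p0 * x 0 + p1 * x 1 + h ≤ g x) →
    (∀ x : Fin 2 → ℝ, |a0 * x 0 + a1 * x 1| ≤ 20 → |b0 * x 0 + b1 * x 1| ≤ 20 →
      p0 * x 0 + p1 * x 1 + h - g x ≤ 22 * h) →
    (∀ x : Fin 2 → ℝ, ‖x‖ ≤ R → h / 2 ≤ p0 * x 0 + p1 * x 1 + h - g x) → D ≤ h →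
    ajCut w (pd 0 (pd 0 g)) (pd 0 (pd 1 g)) (pd 1 (pd 1 g)) C R := by
  obtain ⟨k, K, hK, hk, k01, k1, k0, kK⟩ := aj_kappa
  refine ⟨K * (22 ^ 2 * 1600), ?_⟩
  intro g w R h D a0 a1 b0 b1 p0 p1 hg hw ha0 hS hw0 hwS hpde hh hD hdet hoff hon hR hDh
  set v : (Fin 2 → ℝ) → ℝ := fun y => h⁻¹ * ((p0 * y 0 + p1 * y 1) + (h - g y)) with hv
  have dg := ajI_diff hg
  have hvs : ContDiff ℝ (⊤ : ℕ∞) v := by fun_prop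
  have dv := ajI_diff hvs
  have v1 : ∀ i x, pd i v x = h⁻¹ * (![p0, p1] i - pd i g x) := by
    intro i x
    rw [hv, aj_cmul _ (by fun_prop), aj_add (f := fun y => p0 * y 0 + p1 * y 1) (g := fun y => h - g y)
      (by fun_prop) (by fun_prop), aj_form, aj_sub (f := fun _ => h) (by fun_prop) dg, aj_const]
    ring
  have v2 : ∀ i j x, pd i (pd j v) x = - h⁻¹ * pd i (pd j g) x := by
    intro i j x
    have dj := ajI_diff (aj_smI hg j)
    rw [show pd j v = fun x => h⁻¹ * (![p0, p1] j - pd j g x) from funext (v1 j),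
      aj_cmul _ (by fun_prop), aj_sub (f := fun _ => ![p0, p1] j) (by fun_prop) dj, aj_const]
    ring
  have voff : ∀ x : Fin 2 → ℝ, ¬ (|a0 * x 0 + a1 * x 1| ≤ 20 ∧ |b0 * x 0 + b1 * x 1| ≤ 20) → v x ≤ 0 := by
    intro x hx
    rw [not_and_or, not_le, not_le] at hx
    have := hoff x hx
    exact mul_nonpos_of_nonneg_of_nonpos (by positivity) (by linarith)
  have von : ∀ x : Fin 2 → ℝ, |a0 * x 0 + a1 * x 1| ≤ 20 → |b0 * x 0 + b1 * x 1| ≤ 20 → v x ≤ 22 := by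
    intro x h1 h2
    have := hon x h1 h2
    show h⁻¹ * _ ≤ _
    rw [inv_mul_le_iff₀ hh]
    linarith
  have vR : ∀ x : Fin 2 → ℝ, ‖x‖ ≤ R → 1/2 ≤ v x := by
    intro x hx
    have := hR x hx
    show _ ≤ h⁻¹ * _
    rw [le_inv_mul_iff₀ hh]
    linarith
  have ga := aj_smI (aj_smI hg 0) 0
  have gb := aj_smI (aj_smI hg 1) 0
  have gd := aj_smI (aj_smI hg 1) 1
  have ca := ga.continuous
  have cb := gb.continuous
  have cd := gd.continuous
  have cw := hw.continuous
  have cv := hvs.continuous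
  have hbox := aj_box_compact hdet 20
  have hη : ContDiff ℝ (⊤ : ℕ∞) (fun y => k (v y)) := hk.comp hvs
  have hηc : HasCompactSupport (fun y => k (v y)) :=
    HasCompactSupport.intro hbox (fun x hx => k0 _ (voff x hx))
  have hφ : ContDiff ℝ 2 (fun y => max 0 (v y) ^ 3) := aj_max3.comp (ajI_2 hvs)
  have hφc : HasCompactSupport (fun y => max 0 (v y) ^ 3) :=
    HasCompactSupport.intro hbox (fun x hx => by rw [max_eq_left (voff x hx)]; norm_num)
  have φ1 : ∀ j, pd j (fun y => max 0 (v y) ^ 3) = fun y => (3 * max 0 (v y) ^ 2) * pd j v y := by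
    intro j; ext x
    exact aj_comp (k := fun t => max 0 t ^ 3) (k' := fun t => 3 * max 0 t ^ 2) dv j x (aj_hd3 _)
  have φ2 : ∀ i j x, pd i (pd j (fun y => max 0 (v y) ^ 3)) x =
      6 * max 0 (v x) * pd i v x * pd j v x + 3 * max 0 (v x) ^ 2 * (- h⁻¹ * pd i (pd j g) x) := by
    intro i j x
    have dm : Differentiable ℝ (fun y => 3 * max 0 (v y) ^ 2) :=
      (aj_max2.differentiable one_ne_zero).comp dv
    rw [φ1, aj_mul dm (ajI_diff (aj_smI hvs j)), v2,
      aj_comp (k := fun t => 3 * max 0 t ^ 2) (k' := fun t => 6 * max 0 t) dv i x (aj_hd2 _)]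
  have cv0 := (aj_smI hvs 0).continuous
  have cv1 := (aj_smI hvs 1).continuous
  have ibp := aj_ibpw ga gb gd hw (fun x => aj_comm (ajI_2 (aj_smI hg 0)) x |>.trans (by
      rw [show pd 1 (pd 0 g) = pd 0 (pd 1 g) from funext (aj_comm (ajI_2 hg))])) (fun x => aj_comm (ajI_2 (aj_smI hg 1)) x) hpde hφ hφc
  have I1 : MeasureTheory.Integrable (fun x => max 0 (v x) * ajQ w (pd 0 (pd 0 g)) (pd 0 (pd 1 g)) (pd 1 (pd 1 g)) v x) := by
    have := ajQ_cont cw ca cb cd (ajI_1 hvs)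
    apply Continuous.integrable_of_hasCompactSupport (by fun_prop)
    exact HasCompactSupport.intro hbox (fun x hx => by rw [max_eq_left (voff x hx)]; simp)
  have I2 : MeasureTheory.Integrable (fun x => h⁻¹ * max 0 (v x) ^ 2) := by
    apply Continuous.integrable_of_hasCompactSupport (by fun_prop)
    exact HasCompactSupport.intro hbox (fun x hx => by rw [max_eq_left (voff x hx)]; simp)
  have ibp2 : ∫ x, max 0 (v x) * ajQ w (pd 0 (pd 0 g)) (pd 0 (pd 1 g)) (pd 1 (pd 1 g)) v x = ∫ x, h⁻¹ * max 0 (v x) ^ 2 := by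
    rw [← sub_eq_zero, ← MeasureTheory.integral_sub I1 I2]
    have e : (fun x => max 0 (v x) * ajQ w (pd 0 (pd 0 g)) (pd 0 (pd 1 g)) (pd 1 (pd 1 g)) v x - h⁻¹ * max 0 (v x) ^ 2)
      = fun x => (1/6 : ℝ) * (w x * (pd 1 (pd 1 g) x * pd 0 (pd 0 (fun y => max 0 (v y) ^ 3)) x - 2 * pd 0 (pd 1 g) x * pd 0 (pd 1 (fun y => max 0 (v y) ^ 3)) x + pd 0 (pd 0 g) x * pd 1 (pd 1 (fun y => max 0 (v y) ^ 3)) x)) := by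
      ext x
      rw [φ2, φ2, φ2]
      unfold ajQ
      linear_combination h⁻¹ * max 0 (v x) ^ 2 * hwS x
    rw [e, MeasureTheory.integral_const_mul, ibp, mul_zero]
  refine ⟨_, ajI_1 hη, hηc, fun x => k01 _, fun x hx => k1 _ (vR x hx), ?_⟩
  calc ∫ x, ajQ w (pd 0 (pd 0 g)) (pd 0 (pd 1 g)) (pd 1 (pd 1 g)) (fun y => k (v y)) x
      ≤ ∫ x, K * (max 0 (v x) * ajQ w (pd 0 (pd 0 g)) (pd 0 (pd 1 g)) (pd 1 (pd 1 g)) v x) := by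
        apply MeasureTheory.integral_mono (ajQ_int cw ca cb cd (ajI_1 hη) hηc) (I1.const_mul K)
        intro x
        have dk : HasDerivAt k (deriv k (v x)) (v x) := (hk.differentiable (by simp) _).hasDerivAt
        have e : ∀ i, pd i (fun y => k (v y)) x = deriv k (v x) * pd i v x := fun i =>
          aj_comp (k' := deriv k) dv i x dk
        have q := aj_qpos (ξ := pd 0 v x) (ζ := pd 1 v x) (ha0 x) (hS x)
        have q' : 0 ≤ ajQ w (pd 0 (pd 0 g)) (pd 0 (pd 1 g)) (pd 1 (pd 1 g)) v x := mul_nonneg (hw0 x).le q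
        have r := mul_le_mul_of_nonneg_right (kK (v x)) q'
        refine le_trans (le_of_eq ?_) (r.trans (le_of_eq (by ring)))
        unfold ajQ
        rw [e, e]
        ring
    _ = K * ∫ x, h⁻¹ * max 0 (v x) ^ 2 := by rw [MeasureTheory.integral_const_mul, ibp2]
    _ ≤ K * ((h⁻¹ * 22 ^ 2) * (4 * 20 ^ 2 * D)) := by
        apply mul_le_mul_of_nonneg_left _ hK
        apply aj_area hD hdet (by norm_num) I2
        · intro x h1 h2
          have := von x h1 h2
          have hm : max 0 (v x) ≤ 22 := max_le (by norm_num) this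
          have : max 0 (v x) ^ 2 ≤ 22 ^ 2 := pow_le_pow_left₀ (le_max_left _ _) hm 2
          exact mul_le_mul_of_nonneg_left this (by positivity)
        · intro x hx
          rw [max_eq_left (voff x hx)]; simp
    _ ≤ K * (22 ^ 2 * 1600) := by
        apply mul_le_mul_of_nonneg_left _ hK
        have : (h⁻¹ * 22 ^ 2) * (4 * 20 ^ 2 * D) = (22 ^ 2 * 1600) * (D / h) := by
          field_simp; ring
        rw [this]
        apply mul_le_of_le_one_right (by norm_num)
        rwa [div_le_one hh]

theorem aj_cut_mono {m a b d : (Fin 2 → ℝ) → ℝ} {C C' R R' : ℝ} (h : ajCut m a b d C R) (hC : C ≤ C')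
    (hR : R' ≤ R) : ajCut m a b d C' R' := by
  obtain ⟨η, h1, h2, h3, h4, h5⟩ := h
  exact ⟨η, h1, h2, h3, fun x hx => h4 x (hx.trans hR), h5.trans hC⟩

theorem aj_cuts {g w : (Fin 2 → ℝ) → ℝ} (hg : ContDiff ℝ (⊤ : ℕ∞) g) (hw : ContDiff ℝ (⊤ : ℕ∞) w)
    (ha0 : ∀ x, 0 < pd 0 (pd 0 g) x)
    (hS : ∀ x, 0 < pd 0 (pd 0 g) x * pd 1 (pd 1 g) x - pd 0 (pd 1 g) x ^ 2)
    (hw0 : ∀ x, 0 < w x)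
    (hwS : ∀ x, w x * (pd 0 (pd 0 g) x * pd 1 (pd 1 g) x - pd 0 (pd 1 g) x ^ 2) = 1)
    (hpde : ∀ x, pd 1 (pd 1 g) x * pd 0 (pd 0 w) x - 2 * pd 0 (pd 1 g) x * pd 0 (pd 1 w) x +
      pd 0 (pd 0 g) x * pd 1 (pd 1 w) x = 0)
    (h0 : g 0 = 0) (hp0 : pd 0 g 0 = 0) (hp1 : pd 1 g 0 = 0) :
    ∃ C, ∀ R, ajCut (fun _ => 1) (pd 0 (pd 0 g)) (pd 0 (pd 1 g)) (pd 1 (pd 1 g)) C R ∨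
      ajCut w (pd 0 (pd 0 g)) (pd 0 (pd 1 g)) (pd 1 (pd 1 g)) C R := by
  obtain ⟨C1, hC1⟩ := aj_E1
  obtain ⟨C0, hC0⟩ := aj_E0
  have hsc := aj_sconv hg ha0 hS
  have hc := hsc.convexOn
  have hn := aj_nonneg (ajI_diff hg) hc h0 hp0 hp1
  have hco := aj_coercive hg.continuous hsc h0 hn
  refine ⟨max C1 C0, fun R => ?_⟩
  obtain ⟨h, D, a0, a1, b0, b1, hh, hD, hdet, hin, hout, hR⟩ :=
    aj_geom hg.continuous hc h0 hn hco (R := max R 1) (le_max_right _ _)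
  rcases le_total h D with hhD | hDh
  · left
    exact aj_cut_mono (hC1 g (max R 1) h D a0 a1 b0 b1 hg ha0 hS hn hD hdet hout hR hhD)
      (le_max_left _ _) (le_max_left _ _)
  · right
    set α : (Fin 2 → ℝ) →ₗ[ℝ] ℝ := a0 • LinearMap.proj 0 + a1 • LinearMap.proj 1 with hα
    set β : (Fin 2 → ℝ) →ₗ[ℝ] ℝ := b0 • LinearMap.proj 0 + b1 • LinearMap.proj 1 with hβ
    have eα : ∀ x : Fin 2 → ℝ, α x = a0 * x 0 + a1 * x 1 := fun x => rfl
    have eβ : ∀ x : Fin 2 → ℝ, β x = b0 * x 0 + b1 * x 1 := fun x => rfl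
    simp only [← eα, ← eβ] at hin hout hR
    obtain ⟨p, hpo, hpi⟩ := aj_sep hg.continuous hc h0 hn α β hh hin hout
    have ep : ∀ x : Fin 2 → ℝ, p x = p (Pi.single 0 1) * x 0 + p (Pi.single 1 1) * x 1 := by
      intro x
      have hx : x = x 0 • (Pi.single 0 1 : Fin 2 → ℝ) + x 1 • (Pi.single 1 1 : Fin 2 → ℝ) := by
        ext i; fin_cases i <;> simp
      conv_lhs => rw [hx]
      rw [map_add, map_smul, map_smul, smul_eq_mul, smul_eq_mul]; ring
    refine aj_cut_mono (hC0 g w (max R 1) h D a0 a1 b0 b1 (p (Pi.single 0 1)) (p (Pi.single 1 1))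
      hg hw ha0 hS hw0 hwS hpde hh hD hdet ?_ ?_ ?_ hDh) (le_max_right _ _) (le_max_left _ _)
    · intro x hx
      rw [← ep]
      have := hpo x hx
      linarith
    · intro x h1 h2
      rw [← ep]
      have key : ∀ φ : (Fin 2 → ℝ) →ₗ[ℝ] ℝ, |φ x| ≤ 20 → |φ ((1/21:ℝ) • x)| < 1 := by
        intro φ hφ
        rw [map_smul, smul_eq_mul, abs_mul, abs_of_pos (by norm_num)]
        linarith
      have := hpi ((1/21:ℝ) • x) (key α h1) (key β h2)
      rw [map_smul, smul_eq_mul] at this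
      have := hn x
      linarith
    · intro x hx
      rw [← ep]
      obtain ⟨h1, h2⟩ := hR x hx
      have key : ∀ φ : (Fin 2 → ℝ) →ₗ[ℝ] ℝ, |φ x| ≤ 1/8 → |φ ((-4:ℝ) • x)| ≤ 1/2 ∧ |φ ((4:ℝ) • x)| ≤ 1/2 := by
        intro φ hφ
        rw [map_smul, smul_eq_mul, abs_mul, map_smul, smul_eq_mul, abs_mul, abs_neg, abs_of_pos (by norm_num)]
        constructor <;> linarith
      have k1 := key α h1
      have k2 := key β h2
      have u1 := hpi ((-4:ℝ) • x) (by linarith [k1.1]) (by linarith [k2.1])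
      rw [map_smul, smul_eq_mul] at u1
      have u2 := hout ((4:ℝ) • x) (by linarith [k1.2, k2.2])
      have u3 := hn (-((4:ℝ) • x))
      have u4 := hc.2 (Set.mem_univ ((4:ℝ) • x)) (Set.mem_univ 0) (show (0:ℝ) ≤ 1/4 by norm_num)
        (show (0:ℝ) ≤ 3/4 by norm_num) (by norm_num)
      rw [smul_smul, h0] at u4
      norm_num at u4
      linarith

theorem aj_main {f w : (Fin 2 → ℝ) → ℝ} (hf : ContDiff ℝ (⊤ : ℕ∞) f) (hw : ContDiff ℝ (⊤ : ℕ∞) w)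
    (ha0 : ∀ x, 0 < pd 0 (pd 0 f) x)
    (hS : ∀ x, 0 < pd 0 (pd 0 f) x * pd 1 (pd 1 f) x - pd 0 (pd 1 f) x ^ 2)
    (hw0 : ∀ x, 0 < w x)
    (hwS : ∀ x, w x * (pd 0 (pd 0 f) x * pd 1 (pd 1 f) x - pd 0 (pd 1 f) x ^ 2) = 1)
    (hpde : ∀ x, pd 1 (pd 1 f) x * pd 0 (pd 0 w) x - 2 * pd 0 (pd 1 f) x * pd 0 (pd 1 w) x +
      pd 0 (pd 0 f) x * pd 1 (pd 1 w) x = 0) : IsQuadratic f := by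
  set P := pd 0 f 0 with hP
  set Q := pd 1 f 0 with hQ
  set c := f 0 with hc
  set g : (Fin 2 → ℝ) → ℝ := fun y => f y - ((P * y 0 + Q * y 1) + c) with hgdef
  have df := ajI_diff hf
  have hg : ContDiff ℝ (⊤ : ℕ∞) g := by fun_prop
  have g1 : ∀ i, pd i g = fun x => pd i f x - ![P, Q] i := by
    intro i; ext x
    rw [hgdef, aj_sub (g := fun y => (P * y 0 + Q * y 1) + c) df (by fun_prop),
      aj_add (f := fun y => P * y 0 + Q * y 1) (by fun_prop) (by fun_prop), aj_form, aj_const, add_zero]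
  have g2 : ∀ i j, pd i (pd j g) = pd i (pd j f) := by
    intro i j; ext x
    rw [g1, aj_sub (ajI_diff (aj_smI hf j)) (by fun_prop), aj_const, sub_zero]
  have hcuts := aj_cuts (g := g) (w := w) hg hw (by rwa [g2]) (by rwa [g2, g2, g2]) hw0 (by rwa [g2, g2, g2])
    (by rwa [g2, g2, g2]) (by simp [hgdef, hc]) (by rw [g1]; simp [hP]) (by rw [g1]; simp [hQ])
  rw [g2, g2, g2] at hcuts
  obtain ⟨C, hC⟩ := hcuts
  have ga := aj_smI (aj_smI hf 0) 0
  have gb := aj_smI (aj_smI hf 1) 0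
  have gd := aj_smI (aj_smI hf 1) 1
  have hab : ∀ x, pd 1 (pd 0 (pd 0 f)) x = pd 0 (pd 0 (pd 1 f)) x := by
    intro x
    rw [aj_comm (ajI_2 (aj_smI hf 0)), show pd 1 (pd 0 f) = pd 0 (pd 1 f) from funext (aj_comm (ajI_2 hf))]
  have hbd : ∀ x, pd 1 (pd 0 (pd 1 f)) x = pd 0 (pd 1 (pd 1 f)) x :=
    fun x => aj_comm (ajI_2 (aj_smI hf 1)) x
  have fin : ∀ C', (∀ x, pd 0 w x = 0 ∧ pd 1 w x = 0) →
      (∀ R, ajCut (fun _ => 1) (pd 0 (pd 0 f)) (pd 0 (pd 1 f)) (pd 1 (pd 1 f)) C' R) → IsQuadratic f := by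
    intro C' hz hcut
    have hwc := aj_zero_const (ajI_diff hw) hz
    have hcc : ∀ x, pd 0 (pd 0 f) x * pd 1 (pd 1 f) x - pd 0 (pd 1 f) x * pd 0 (pd 1 f) x = (w 0)⁻¹ := by
      intro x
      have := hwS x
      rw [hwc x] at this
      rw [← sq]
      exact eq_inv_of_mul_eq_one_right this
    have hj := aj_jorg ga gb gd hab hbd ha0 hS hcc hcut
    exact aj_quad hf (fun x => (hj x).1) (fun x => (hj x).2.1) (fun x => (hj x).2.2)
  by_cases hall : ∀ R, ajCut (fun _ => 1) (pd 0 (pd 0 f)) (pd 0 (pd 1 f)) (pd 1 (pd 1 f)) C R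
  · exact fin C (aj_K1 ga gb gd hw hab hbd ha0 hS hw0 hpde hall) hall
  · push Not at hall
    obtain ⟨R0, hR0⟩ := hall
    have hall' : ∀ R, ajCut w (pd 0 (pd 0 f)) (pd 0 (pd 1 f)) (pd 1 (pd 1 f)) C R := by
      intro R
      rcases hC (max R R0) with h | h
      · exact absurd (aj_cut_mono h le_rfl (le_max_right _ _)) hR0
      · exact aj_cut_mono h le_rfl (le_max_left _ _)
    have hz := aj_K0 ga gb gd hw hab hbd ha0 hS hw0 hwS hpde hall'
    have hwc := aj_zero_const (ajI_diff hw) hz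
    refine fin ((w 0)⁻¹ * C) hz ?_
    intro R
    obtain ⟨η, h1, h2, h3, h4, h5⟩ := hall' R
    refine ⟨η, h1, h2, h3, h4, ?_⟩
    have e : ajQ (fun _ => 1) (pd 0 (pd 0 f)) (pd 0 (pd 1 f)) (pd 1 (pd 1 f)) η =
        fun x => (w 0)⁻¹ * ajQ w (pd 0 (pd 0 f)) (pd 0 (pd 1 f)) (pd 1 (pd 1 f)) η x := by
      ext x
      unfold ajQ
      rw [hwc x, ← mul_assoc, inv_mul_cancel₀ (hw0 0).ne']
    rw [e, MeasureTheory.integral_const_mul]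
    exact mul_le_mul_of_nonneg_left h5 (inv_pos.2 (hw0 0)).le

theorem aj_statement (f : (Fin 2 → ℝ) → ℝ)
    (hsmooth : ContDiff ℝ (⊤ : ℕ∞) f)
    (hconv : ∀ x, (hess f x).PosDef)
    (hpde : ∀ x : Fin 2 → ℝ, ∑ i, ∑ j,
      cof (hess f x) i j * pd i (pd j fun y => ((hess f y).det)⁻¹) x = 0) :
    IsQuadratic f := by
  have ecomm : pd 1 (pd 0 f) = pd 0 (pd 1 f) := funext (aj_comm (ajI_2 hsmooth))
  have ga := aj_smI (aj_smI hsmooth 0) 0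
  have gb := aj_smI (aj_smI hsmooth 1) 0
  have gd := aj_smI (aj_smI hsmooth 1) 1
  have hdet : ∀ x, (hess f x).det = pd 0 (pd 0 f) x * pd 1 (pd 1 f) x - pd 0 (pd 1 f) x ^ 2 := by
    intro x
    rw [Matrix.det_fin_two]
    simp only [hess, Matrix.of_apply, ecomm]
    ring
  have hS : ∀ x, 0 < pd 0 (pd 0 f) x * pd 1 (pd 1 f) x - pd 0 (pd 1 f) x ^ 2 := by
    intro x; rw [← hdet]; exact (hconv x).det_pos
  have ew : (fun y => ((hess f y).det)⁻¹) =
      fun y => (pd 0 (pd 0 f) y * pd 1 (pd 1 f) y - pd 0 (pd 1 f) y ^ 2)⁻¹ := by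
    ext y; rw [hdet]
  rw [ew] at hpde
  set w : (Fin 2 → ℝ) → ℝ := fun y => (pd 0 (pd 0 f) y * pd 1 (pd 1 f) y - pd 0 (pd 1 f) y ^ 2)⁻¹ with hwdef
  have hw : ContDiff ℝ (⊤ : ℕ∞) w := ((ga.mul gd).sub (gb.pow 2)).inv (fun x => (hS x).ne')
  refine aj_main hsmooth hw (fun x => (hconv x).diag_pos (i := 0)) hS (fun x => inv_pos.2 (hS x))
    (fun x => inv_mul_cancel₀ (hS x).ne') ?_
  intro x
  have := hpde x
  simp only [Fin.sum_univ_two, cof, Matrix.transpose_apply, Matrix.adjugate_fin_two, hess, Matrix.of_apply,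
    Matrix.cons_val', Matrix.cons_val_zero, Matrix.cons_val_one, Matrix.cons_val_fin_one, ecomm] at this
  rw [aj_comm (ajI_2 hw)] at this
  linear_combination this

/-- the Li–Jia conjecture for `n = 2`. A smooth, strictly convex solution of
the Abreu equation (`w = (det D²f)⁻¹`) on all of `ℝ²` is a quadratic polynomial. -/
theorem statement2 (f : (Fin 2 → ℝ) → ℝ)
    (hsmooth : ContDiff ℝ (⊤ : ℕ∞) f)
    (hconv : ∀ x, (hess f x).PosDef)
    (hpde : ∀ x : Fin 2 → ℝ, ∑ i, ∑ j,
      cof (hess f x) i j * pd i (pd j fun y => ((hess f y).det)⁻¹) x = 0) :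
    IsQuadratic f := by
  exact aj_statement f hsmooth hconv hpde
end

section
/- Let f be a smooth, strictly convex function on a domain Ω ⊆ ℝⁿ and a ≠ 0 a real constant. Then f satisfies ∑_{i,j=1}^{n} F^{ij} ∂²w/∂x_i∂x_j = 0 with w := [det(∂²f/∂x_i∂x_j)]^a on Ω if and only if ρ satisfies Δρ = −β·‖grad ρ‖²/ρ on Ω, where β := −((n+2)(2a+1)+2)/2. -/
open Real Filter Topology Matrix

section Helpers

variable {n : ℕ}

lemma pd_congr {g h : (Fin n → ℝ) → ℝ} {x : Fin n → ℝ} (e : g =ᶠ[𝓝 x] h) (i : Fin n) :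
    pd i g x = pd i h x := by
  unfold pd
  rw [e.fderiv_eq]

lemma pd_mul {g h : (Fin n → ℝ) → ℝ} {x : Fin n → ℝ} (hg : DifferentiableAt ℝ g x)
    (hh : DifferentiableAt ℝ h x) (i : Fin n) :
    pd i (fun y => g y * h y) x = pd i g x * h x + g x * pd i h x := by
  unfold pd
  rw [fderiv_fun_mul hg hh]
  simp
  ring

lemma pd_sum {ι : Type*} (s : Finset ι) {g : ι → (Fin n → ℝ) → ℝ} {x : Fin n → ℝ}
    (hg : ∀ k ∈ s, DifferentiableAt ℝ (g k) x) (i : Fin n) :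
    pd i (fun y => ∑ k ∈ s, g k y) x = ∑ k ∈ s, pd i (g k) x := by
  unfold pd
  rw [fderiv_fun_sum hg]
  simp

lemma pd_const (c : ℝ) (x : Fin n → ℝ) (i : Fin n) : pd i (fun _ => c) x = 0 := by
  unfold pd
  simp

lemma pd_smooth {g : (Fin n → ℝ) → ℝ} {x : Fin n → ℝ} (hg : ContDiffAt ℝ (⊤ : ℕ∞) g x)
    (i : Fin n) : ContDiffAt ℝ (⊤ : ℕ∞) (pd i g) x := by
  unfold pd
  exact (hg.fderiv_right (m := (⊤ : ℕ∞)) (by simp)).clm_apply contDiffAt_const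

lemma sm_diff {g : (Fin n → ℝ) → ℝ} {x : Fin n → ℝ} (hg : ContDiffAt ℝ (⊤ : ℕ∞) g x) :
    DifferentiableAt ℝ g x := hg.differentiableAt (by simp)

lemma pd_comm {g : (Fin n → ℝ) → ℝ} {x : Fin n → ℝ} (hg : ContDiffAt ℝ (⊤ : ℕ∞) g x)
    (i j : Fin n) : pd i (pd j g) x = pd j (pd i g) x := by
  have hs := (hg.isSymmSndFDerivAt (by
    simp only [minSmoothness_of_isRCLikeNormedField]; exact WithTop.coe_le_coe.2 (le_top : (2 : ℕ∞) ≤ ⊤))).eq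
    (Pi.single i 1) (Pi.single j 1)
  have hd : DifferentiableAt ℝ (fderiv ℝ g) x :=
    (hg.fderiv_right (m := (⊤ : ℕ∞)) (by simp)).differentiableAt (by simp)
  have key : ∀ i j : Fin n, pd i (pd j g) x
      = fderiv ℝ (fderiv ℝ g) x (Pi.single i 1) (Pi.single j 1) := by
    intro i j
    unfold pd
    rw [fderiv_clm_apply hd (differentiableAt_const _)]
    simp
  rw [key, key, hs]

lemma det_smooth {H : (Fin n → ℝ) → Matrix (Fin n) (Fin n) ℝ} {x : Fin n → ℝ}
    (hH : ∀ i j, ContDiffAt ℝ (⊤ : ℕ∞) (fun y => H y i j) x) :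
    ContDiffAt ℝ (⊤ : ℕ∞) (fun y => (H y).det) x := by
  simp only [Matrix.det_apply']
  exact ContDiffAt.sum fun s _ => contDiffAt_const.mul (contDiffAt_prod fun i _ => hH _ _)

lemma inv_smooth {H : (Fin n → ℝ) → Matrix (Fin n) (Fin n) ℝ} {x : Fin n → ℝ}
    (hH : ∀ i j, ContDiffAt ℝ (⊤ : ℕ∞) (fun y => H y i j) x) (h0 : (H x).det ≠ 0)
    (i j : Fin n) : ContDiffAt ℝ (⊤ : ℕ∞) (fun y => (H y)⁻¹ i j) x := by
  simp only [Matrix.inv_def, Ring.inverse_eq_inv', Matrix.smul_apply, smul_eq_mul,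
    Matrix.adjugate_apply]
  refine ((det_smooth hH).inv h0).mul (det_smooth fun p q => ?_)
  simp only [Matrix.updateRow_apply]
  split_ifs
  · exact contDiffAt_const
  · exact hH _ _

lemma pd_det {H : (Fin n → ℝ) → Matrix (Fin n) (Fin n) ℝ} {x : Fin n → ℝ}
    (hH : ∀ i j, DifferentiableAt ℝ (fun y => H y i j) x) (k : Fin n) :
    pd k (fun y => (H y).det) x
      = ∑ i, ∑ j, (H x).adjugate j i * pd k (fun y => H y i j) x := by
  let D : ContinuousMultilinearMap ℝ (fun _ : Fin n => Fin n → ℝ) ℝ :=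
    { (Matrix.detRowAlternating (n := Fin n) (R := ℝ)).toMultilinearMap with
      cont := (continuous_id (X := Matrix (Fin n) (Fin n) ℝ)).matrix_det }
  let H' : (Fin n → ℝ) → Fin n → Fin n → ℝ := fun y i j => H y i j
  have hd : HasFDerivAt H' (ContinuousLinearMap.pi fun i => ContinuousLinearMap.pi fun j =>
      fderiv ℝ (fun y => H y i j) x) x :=
    hasFDerivAt_pi.2 fun i => hasFDerivAt_pi.2 fun j => (hH i j).hasFDerivAt
  have h2 := (D.hasFDerivAt (H' x)).comp x hd
  have h3 : HasFDerivAt (fun y => (H y).det) _ x := h2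
  unfold pd
  rw [h3.fderiv, ContinuousLinearMap.comp_apply, ContinuousMultilinearMap.linearDeriv_apply]
  refine Finset.sum_congr rfl fun i _ => ?_
  have h4 : ∀ r : Fin n → ℝ, D (Function.update (H' x) i r)
      = ∑ j, (H x).adjugate j i * r j := by
    intro r
    change ((H x).updateRow i r).det = _
    rw [← Matrix.cramer_transpose_apply, Matrix.cramer_eq_adjugate_mulVec,
      ← Matrix.adjugate_transpose]
    simp [Matrix.mulVec, dotProduct]
  rw [h4]
  rfl

lemma pd_inv {H : (Fin n → ℝ) → Matrix (Fin n) (Fin n) ℝ} {x : Fin n → ℝ}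
    (hH : ∀ i j, ContDiffAt ℝ (⊤ : ℕ∞) (fun y => H y i j) x) (h0 : (H x).det ≠ 0)
    (k i j : Fin n) : pd k (fun y => (H y)⁻¹ i j) x
      = - ∑ q, (∑ p, (H x)⁻¹ i p * pd k (fun y => H y p q) x) * (H x)⁻¹ q j := by
  let A : Matrix (Fin n) (Fin n) ℝ := Matrix.of fun i j => pd k (fun y => (H y)⁻¹ i j) x
  let B : Matrix (Fin n) (Fin n) ℝ := Matrix.of fun i j => pd k (fun y => H y i j) x
  have hev : ∀ᶠ y in 𝓝 x, (H y).det ≠ 0 := (det_smooth hH).continuousAt.eventually_ne h0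
  have hu : IsUnit (H x).det := isUnit_iff_ne_zero.2 h0
  have hAB : A * H x + (H x)⁻¹ * B = 0 := by
    ext a b
    have e1 : pd k (fun y => ∑ p, (H y)⁻¹ a p * H y p b) x = 0 := by
      rw [← pd_const ((1 : Matrix (Fin n) (Fin n) ℝ) a b) x k]
      refine pd_congr ?_ k
      filter_upwards [hev] with y hy
      rw [← Matrix.mul_apply, Matrix.nonsing_inv_mul _ (isUnit_iff_ne_zero.2 hy)]
    rw [pd_sum _ (fun p _ => (sm_diff (inv_smooth hH h0 a p)).fun_mul (sm_diff (hH p b)))] at e1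
    rw [Matrix.add_apply, Matrix.mul_apply, Matrix.mul_apply, ← Finset.sum_add_distrib,
      Matrix.zero_apply, ← e1]
    refine Finset.sum_congr rfl fun p _ => ?_
    rw [pd_mul (sm_diff (inv_smooth hH h0 a p)) (sm_diff (hH p b))]
    rfl
  have hA : A = -((H x)⁻¹ * B * (H x)⁻¹) := by
    have : A * H x * (H x)⁻¹ = -((H x)⁻¹ * B) * (H x)⁻¹ := by
      rw [eq_neg_of_add_eq_zero_left hAB]
    rwa [Matrix.mul_assoc, Matrix.mul_nonsing_inv _ hu, Matrix.mul_one, Matrix.neg_mul] at this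
  have := congrFun (congrFun hA i) j
  simpa [A, B, Matrix.mul_apply] using this

lemma pd_rpow {g : (Fin n → ℝ) → ℝ} {x : Fin n → ℝ} (hg : DifferentiableAt ℝ g x)
    (h0 : 0 < g x) (p : ℝ) (i : Fin n) :
    pd i (fun y => g y ^ p) x = p * g x ^ p * pd i (fun y => Real.log (g y)) x := by
  unfold pd
  rw [(hg.hasFDerivAt.rpow_const (Or.inl h0.ne')).fderiv, fderiv.log hg h0.ne']
  simp only [_root_.smul_apply, smul_eq_mul]
  rw [Real.rpow_sub_one h0.ne']
  ring

lemma pd_log {g : (Fin n → ℝ) → ℝ} {x : Fin n → ℝ} (hg : DifferentiableAt ℝ g x)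
    (h0 : 0 < g x) (i : Fin n) :
    pd i (fun y => Real.log (g y)) x = (g x)⁻¹ * pd i g x := by
  unfold pd
  rw [fderiv.log hg h0.ne']
  simp

lemma pd_pd_rpow {g : (Fin n → ℝ) → ℝ} {x : Fin n → ℝ} (hg : ContDiffAt ℝ (⊤ : ℕ∞) g x)
    (hg' : ∀ᶠ y in 𝓝 x, DifferentiableAt ℝ g y)
    (h0 : 0 < g x) (p : ℝ) (i j : Fin n) :
    pd i (pd j (fun y => g y ^ p)) x = p * g x ^ p * (pd i (pd j fun y => Real.log (g y)) x
      + p * pd i (fun y => Real.log (g y)) x * pd j (fun y => Real.log (g y)) x) := by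
  have hev : ∀ᶠ y in 𝓝 x, 0 < g y := hg.continuousAt.eventually (lt_mem_nhds h0)
  have e : pd j (fun y => g y ^ p) =ᶠ[𝓝 x]
      fun y => p * (g y ^ p * pd j (fun y => Real.log (g y)) y) := by
    filter_upwards [hev, hg'] with y hy hy'
    rw [pd_rpow hy' hy]
    ring
  have hp : DifferentiableAt ℝ (fun y => g y ^ p) x :=
    (sm_diff hg).rpow_const (Or.inl h0.ne')
  have hl : DifferentiableAt ℝ (pd j fun y => Real.log (g y)) x :=
    sm_diff (pd_smooth (hg.log h0.ne') j)
  rw [pd_congr e, pd_mul (differentiableAt_const p) (hp.fun_mul hl), pd_const, pd_mul hp hl,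
    pd_rpow (sm_diff hg) h0]
  ring

end Helpers

lemma key_point {n : ℕ} (a b : ℝ) (Ω : Set (Fin n → ℝ)) (hΩ : IsOpen Ω)
    (f : (Fin n → ℝ) → ℝ) (hsmooth : ContDiffOn ℝ (⊤ : ℕ∞) f Ω)
    (hconv : ∀ x ∈ Ω, (hess f x).PosDef) (x : Fin n → ℝ) (hx : x ∈ Ω) :
    ∃ S Q : ℝ,
      (∑ i, ∑ j, cof (hess f x) i j * pd i (pd j fun y => (hess f y).det ^ a) x
        = (hess f x).det * a * (hess f x).det ^ a * (S + a * Q)) ∧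
      gradSq f (fun y => (hess f y).det ^ b) x = (b * (hess f x).det ^ b) ^ 2 * Q ∧
      calabiLap f (fun y => (hess f y).det ^ b) x
        = b * (hess f x).det ^ b * (S + (b - 1 / 2) * Q) := by
  have hf : ∀ y ∈ Ω, ContDiffAt ℝ (⊤ : ℕ∞) f y := fun y hy =>
    hsmooth.contDiffAt (hΩ.mem_nhds hy)
  have hH : ∀ y ∈ Ω, ∀ i j, ContDiffAt ℝ (⊤ : ℕ∞) (fun z => hess f z i j) y :=
    fun y hy i j => pd_smooth (pd_smooth (hf y hy) j) i
  have hD : ∀ y ∈ Ω, ContDiffAt ℝ (⊤ : ℕ∞) (fun z => (hess f z).det) y :=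
    fun y hy => det_smooth (hH y hy)
  have hpos : ∀ y ∈ Ω, 0 < (hess f y).det := fun y hy => (hconv y hy).det_pos
  have hev : ∀ᶠ y in 𝓝 x, y ∈ Ω := hΩ.mem_nhds hx
  have hdiff : ∀ᶠ y in 𝓝 x, DifferentiableAt ℝ (fun z => (hess f z).det) y :=
    hev.mono fun y hy => sm_diff (hD y hy)
  have hDx := hpos x hx
  have hpp := fun p i j => pd_pd_rpow (hD x hx) hdiff hDx p i j
  have hp := fun p i => pd_rpow (sm_diff (hD x hx)) hDx p i
  set u : Fin n → ℝ := fun i => pd i (fun y => Real.log (hess f y).det) x with hu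
  set v : Fin n → Fin n → ℝ := fun i j =>
    pd i (pd j fun y => Real.log (hess f y).det) x with hv
  set D := (hess f x).det with hDdef
  set G := (hess f x)⁻¹ with hG
  have hadj : (hess f x).adjugate = D • G := by
    rw [hG, Matrix.inv_def, Ring.inverse_eq_inv', smul_smul, mul_inv_cancel₀ hDx.ne', one_smul]
  have hsymH : (hess f x)ᵀ = hess f x := by
    ext i j
    exact pd_comm (hf x hx) j i
  have hGs : ∀ i j, G i j = G j i := by
    intro i j
    have : Gᵀ = G := by rw [hG, Matrix.transpose_nonsing_inv, hsymH]
    exact (congrFun (congrFun this j) i)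
  set T : Fin n → Fin n → Fin n → ℝ := fun k i j => pd k (fun y => hess f y i j) x with hT
  have hT1 : ∀ k i j, T k i j = T i k j := fun k i j =>
    pd_comm (pd_smooth (hf x hx) j) k i
  have hT2 : ∀ k i j, T k i j = T k j i := by
    intro k i j
    refine pd_congr ?_ k
    filter_upwards [hev] with y hy
    exact pd_comm (hf y hy) i j
  have huT : ∀ k, u k = ∑ i, ∑ j, G i j * T k i j := by
    intro k
    simp only [hu]
    rw [pd_log (sm_diff (hD x hx)) hDx, pd_det (fun i j => sm_diff (hH x hx i j)), hadj,
      Finset.mul_sum]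
    refine Finset.sum_congr rfl fun i _ => ?_
    rw [Finset.mul_sum]
    refine Finset.sum_congr rfl fun j _ => ?_
    rw [Matrix.smul_apply, smul_eq_mul, hGs j i, ← mul_assoc, ← mul_assoc,
      inv_mul_cancel₀ hDx.ne', one_mul]
  have hdG : ∀ j, ∑ i, pd i (fun y => (hess f y)⁻¹ i j) x = - ∑ i, u i * G i j := by
    intro j
    simp only [pd_inv (hH x hx) hDx.ne']
    rw [Finset.sum_neg_distrib, Finset.sum_comm]
    congr 1
    refine Finset.sum_congr rfl fun q _ => ?_
    rw [← Finset.sum_mul, huT]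
    congr 1
    refine Finset.sum_congr rfl fun i _ => Finset.sum_congr rfl fun p _ => ?_
    change G i p * T i p q = G i p * T q i p
    rw [hT2 i p q, hT1 i q p]
  refine ⟨∑ i, ∑ j, G i j * v i j, ∑ i, ∑ j, G i j * u i * u j, ?_, ?_, ?_⟩
  · simp only [hpp, cof, hadj, Matrix.transpose_apply, Matrix.smul_apply, smul_eq_mul]
    rw [Finset.mul_sum _ _ a, ← Finset.sum_add_distrib, Finset.mul_sum]
    refine Finset.sum_congr rfl fun i _ => ?_
    rw [Finset.mul_sum _ _ a, ← Finset.sum_add_distrib, Finset.mul_sum]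
    refine Finset.sum_congr rfl fun j _ => ?_
    rw [hGs j i]
    simp only [hu, hv]
    ring
  · simp only [gradSq, hp]
    rw [Finset.mul_sum]
    refine Finset.sum_congr rfl fun i _ => ?_
    rw [Finset.mul_sum]
    refine Finset.sum_congr rfl fun j _ => ?_
    simp only [hu, hG]
    ring
  · have hsD : 0 < √D := Real.sqrt_pos.2 hDx
    have hsd : DifferentiableAt ℝ (fun y => √(hess f y).det) x :=
      (sm_diff (hD x hx)).sqrt hDx.ne'
    have hsp : ∀ i, pd i (fun y => √(hess f y).det) x = 1 / 2 * √D * u i := by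
      intro i
      simp only [Real.sqrt_eq_rpow]
      exact hp _ i
    have hR : ∀ j, DifferentiableAt ℝ (pd j fun y => (hess f y).det ^ b) x := fun j =>
      sm_diff (pd_smooth ((hD x hx).rpow_const_of_ne hDx.ne') j)
    have hterm : ∀ i j, pd i (fun y => √(hess f y).det * (hess f y)⁻¹ i j *
        pd j (fun y => (hess f y).det ^ b) y) x
        = √D * (b * D ^ b * (G i j * v i j + (b + 1 / 2) * (G i j * u i * u j)))
          + √D * (b * D ^ b) * (u j * pd i (fun y => (hess f y)⁻¹ i j) x) := by
      intro i j
      have hGd := sm_diff (inv_smooth (hH x hx) hDx.ne' i j)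
      rw [pd_mul (hsd.fun_mul hGd) (hR j), pd_mul hsd hGd, hsp, hp, hpp]
      simp only [hu, hv, hG]
      ring
    have hQ : ∑ i, ∑ j, u j * pd i (fun y => (hess f y)⁻¹ i j) x
        = - ∑ i, ∑ j, G i j * u i * u j := by
      rw [Finset.sum_comm]
      simp only [← Finset.mul_sum, hdG]
      rw [Finset.sum_comm, ← Finset.sum_neg_distrib]
      refine Finset.sum_congr rfl fun j _ => ?_
      rw [mul_neg, Finset.mul_sum]
      congr 1
      refine Finset.sum_congr rfl fun i _ => ?_
      ring
    simp only [calabiLap, hterm]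
    simp only [Finset.sum_add_distrib, ← Finset.mul_sum, hQ]
    rw [← hDdef]
    field_simp
    ring

/-- for a smooth strictly convex `f` on a domain `Ω ⊆ ℝⁿ` and `a ≠ 0`,
`f` satisfies PDE (1.1) with exponent `a` iff `ρ` satisfies `Δρ = -β ‖grad ρ‖²/ρ`
with `β = -((n+2)(2a+1)+2)/2`. -/
theorem statement3 {n : ℕ} (hn : 0 < n) (a : ℝ) (ha : a ≠ 0)
    (Ω : Set (Fin n → ℝ)) (hΩ : IsOpen Ω)
    (f : (Fin n → ℝ) → ℝ) (hsmooth : ContDiffOn ℝ (⊤ : ℕ∞) f Ω)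
    (hconv : ∀ x ∈ Ω, (hess f x).PosDef) :
    PDE1 f a Ω ↔ PDE2 f (-(((n : ℝ) + 2) * (2 * a + 1) + 2) / 2) Ω := by
  have hnb : ((n : ℝ) + 2) ≠ 0 := by positivity
  have hb : -(1 : ℝ) / ((n : ℝ) + 2) ≠ 0 := div_ne_zero (by norm_num) hnb
  unfold PDE1 PDE2
  refine forall₂_congr fun x hx => ?_
  obtain ⟨S, Q, h1, h2, h3⟩ := key_point a (-(1 : ℝ) / ((n : ℝ) + 2)) Ω hΩ f hsmooth hconv x hx
  have hDx := (hconv x hx).det_pos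
  change _ ↔ calabiLap f (fun y => (hess f y).det ^ (-(1 : ℝ) / ((n : ℝ) + 2))) x
    = _ * gradSq f (fun y => (hess f y).det ^ (-(1 : ℝ) / ((n : ℝ) + 2))) x
      / (hess f x).det ^ (-(1 : ℝ) / ((n : ℝ) + 2))
  rw [h1, h2, h3]
  have hR := Real.rpow_pos_of_pos hDx (-(1 : ℝ) / ((n : ℝ) + 2))
  have hA := Real.rpow_pos_of_pos hDx a
  generalize (hess f x).det ^ (-(1 : ℝ) / ((n : ℝ) + 2)) = R at *
  generalize (hess f x).det ^ a = A at *
  have hc : (hess f x).det * a * A ≠ 0 := mul_ne_zero (mul_ne_zero hDx.ne' ha) hA.ne'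
  have hc' : -(1 : ℝ) / ((n : ℝ) + 2) * R ≠ 0 := mul_ne_zero hb hR.ne'
  rw [mul_eq_zero, or_iff_right hc, ← sub_eq_zero (b := _ / R)]
  have : -(1 : ℝ) / ((n : ℝ) + 2) * R * (S + (-(1 : ℝ) / ((n : ℝ) + 2) - 1 / 2) * Q)
      - -(-(((n : ℝ) + 2) * (2 * a + 1) + 2) / 2) * ((-(1 : ℝ) / ((n : ℝ) + 2) * R) ^ 2 * Q) / R
      = -(1 : ℝ) / ((n : ℝ) + 2) * R * (S + a * Q) := by
    field_simp
    ring
  rw [this, mul_eq_zero, or_iff_right hc']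
end

section
/- Let f be a smooth, strictly convex function on a domain Ω ⊆ ℝ². Then ρ satisfies Δρ = 3·‖grad ρ‖²/ρ on Ω if and only if ∑_{i,j=1}^{2} f^{ij} ∂²/∂x_i∂x_j [ln det(f_kl)] = 0 on Ω. -/
open Real Filter Topology Matrix

open scoped ContDiff

lemma aux_smooth {n : ℕ} {Ω : Set (Fin n → ℝ)} (hΩ : IsOpen Ω) {g : (Fin n → ℝ) → ℝ}
    (hg : ContDiffOn ℝ (⊤ : ℕ∞) g Ω) (i : Fin n) : ContDiffOn ℝ (⊤ : ℕ∞) (pd i g) Ω := by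
  have h := hg.fderiv_of_isOpen (m := (⊤ : ℕ∞)) hΩ (by simp)
  exact h.clm_apply contDiffOn_const

lemma aux_diff {n : ℕ} {Ω : Set (Fin n → ℝ)} (hΩ : IsOpen Ω) {g : (Fin n → ℝ) → ℝ}
    (hg : ContDiffOn ℝ (⊤ : ℕ∞) g Ω) {x : Fin n → ℝ} (hx : x ∈ Ω) : DifferentiableAt ℝ g x :=
  (hg.differentiableOn (by simp)).differentiableAt (hΩ.mem_nhds hx)

lemma aux_congr {n : ℕ} {Ω : Set (Fin n → ℝ)} (hΩ : IsOpen Ω) {g h : (Fin n → ℝ) → ℝ}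
    (hgh : ∀ y ∈ Ω, g y = h y) {x : Fin n → ℝ} (hx : x ∈ Ω) (i : Fin n) :
    pd i g x = pd i h x := by
  have : g =ᶠ[𝓝 x] h := by
    filter_upwards [hΩ.mem_nhds hx] with y hy using hgh y hy
  simp only [pd, this.fderiv_eq]

lemma aux_comm {n : ℕ} {Ω : Set (Fin n → ℝ)} (hΩ : IsOpen Ω) {g : (Fin n → ℝ) → ℝ}
    (hg : ContDiffOn ℝ (⊤ : ℕ∞) g Ω) {x : Fin n → ℝ} (hx : x ∈ Ω) (i j : Fin n) :
    pd i (pd j g) x = pd j (pd i g) x := by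
  have hd : DifferentiableAt ℝ (fderiv ℝ g) x :=
    ((hg.fderiv_of_isOpen (m := (⊤ : ℕ∞)) hΩ (by simp)).differentiableOn
      (by simp)).differentiableAt (hΩ.mem_nhds hx)
  have hs : IsSymmSndFDerivAt ℝ g x :=
    (hg.contDiffAt (hΩ.mem_nhds hx)).isSymmSndFDerivAt (by
      simp only [minSmoothness_of_isRCLikeNormedField]; exact WithTop.coe_le_coe.mpr (le_top : (2 : ℕ∞) ≤ ⊤))
  have key : ∀ a b : Fin n, pd a (pd b g) x
      = fderiv ℝ (fderiv ℝ g) x (Pi.single a 1) (Pi.single b 1) := by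
    intro a b
    show fderiv ℝ (fun y => fderiv ℝ g y (Pi.single b 1)) x (Pi.single a 1) = _
    rw [fderiv_clm_apply hd (differentiableAt_const _)]
    simp
  rw [key, key]
  exact hs _ _

lemma aux_mul {n : ℕ} {g h : (Fin n → ℝ) → ℝ} {x : Fin n → ℝ}
    (hg : DifferentiableAt ℝ g x) (hh : DifferentiableAt ℝ h x) (i : Fin n) :
    pd i (fun y => g y * h y) x = pd i g x * h x + g x * pd i h x := by
  simp only [pd]
  rw [fderiv_fun_mul hg hh]
  simp
  ring

lemma aux_exp {n : ℕ} {g : (Fin n → ℝ) → ℝ} {x : Fin n → ℝ}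
    (hg : DifferentiableAt ℝ g x) (c : ℝ) (i : Fin n) :
    pd i (fun y => Real.exp (c * g y)) x = c * Real.exp (c * g x) * pd i g x := by
  simp only [pd]
  rw [fderiv_exp (hg.const_mul c), fderiv_const_mul hg]
  simp
  ring

lemma aux_neg {n : ℕ} {g : (Fin n → ℝ) → ℝ} {x : Fin n → ℝ} (i : Fin n) :
    pd i (fun y => - g y) x = - pd i g x := by
  simp only [pd]
  rw [fderiv_fun_neg]
  simp

lemma aux_main (Ω : Set (Fin 2 → ℝ)) (hΩ : IsOpen Ω)
    (f : (Fin 2 → ℝ) → ℝ) (hsmooth : ContDiffOn ℝ (⊤ : ℕ∞) f Ω)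
    (hconv : ∀ x ∈ Ω, (hess f x).PosDef) (x : Fin 2 → ℝ) (hx : x ∈ Ω) :
    calabiLap f (rho f) x - 3 * gradSq f (rho f) x / rho f x =
      -(1/4) * rho f x * ∑ i, ∑ j, (hess f x)⁻¹ i j *
        pd i (pd j fun y => Real.log (hess f y).det) x := by
  set L : (Fin 2 → ℝ) → ℝ := fun y => Real.log (hess f y).det with hL
  have hpos : ∀ y ∈ Ω, 0 < (hess f y).det := fun y hy => (hconv y hy).det_pos
  have hD : ∀ y ∈ Ω, (hess f y).det = Real.exp (L y) := fun y hy =>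
    (Real.exp_log (hpos y hy)).symm
  have hS2 : ∀ i j, ContDiffOn ℝ (⊤ : ℕ∞) (pd i (pd j f)) Ω := fun i j =>
    aux_smooth hΩ (aux_smooth hΩ hsmooth j) i
  have hLs : ContDiffOn ℝ (⊤ : ℕ∞) L Ω := by
    have h1 : ContDiffOn ℝ (⊤ : ℕ∞) (fun y => (hess f y).det) Ω := by
      simp only [Matrix.det_fin_two, hess, Matrix.of_apply]
      exact ((hS2 0 0).mul (hS2 1 1)).sub ((hS2 0 1).mul (hS2 1 0))
    exact h1.log fun y hy => (hpos y hy).ne'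
  have hsqrt : ∀ y ∈ Ω, Real.sqrt (hess f y).det = Real.exp ((1/2) * L y) := by
    intro y hy
    rw [Real.sqrt_eq_rpow, Real.rpow_def_of_pos (hpos y hy), mul_comm]
  have hrho : ∀ y ∈ Ω, rho f y = Real.exp ((-(1/4)) * L y) := by
    intro y hy
    rw [rho, Real.rpow_def_of_pos (hpos y hy), mul_comm]
    norm_num [hL]
  have hinv : ∀ y ∈ Ω, ∀ i j, (hess f y)⁻¹ i j =
      Real.exp ((-1) * L y) * (hess f y).adjugate i j := by
    intro y hy i j
    rw [Matrix.inv_def, Matrix.smul_apply, Ring.inverse_eq_inv', hD y hy, ← Real.exp_neg]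
    simp
  have hdrho : ∀ y ∈ Ω, ∀ j, pd j (rho f) y =
      -(1/4) * Real.exp ((-(1/4)) * L y) * pd j L y := by
    intro y hy j
    rw [aux_congr hΩ hrho hy, aux_exp (aux_diff hΩ hLs hy)]
  have hadj : ∀ i j, ContDiffOn ℝ (⊤ : ℕ∞) (fun y => (hess f y).adjugate i j) Ω := by
    intro i j
    simp only [Matrix.adjugate_fin_two, hess, Matrix.of_apply]
    fin_cases i <;> fin_cases j
    · exact hS2 1 1
    · exact (hS2 0 1).neg
    · exact (hS2 1 0).neg
    · exact hS2 0 0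
  have hterm : ∀ i j, pd i (fun y => Real.sqrt (hess f y).det * (hess f y)⁻¹ i j
        * pd j (rho f) y) x
      = -(1/4) * Real.exp ((-(3/4)) * L x) *
        (-(3/4) * pd i L x * (hess f x).adjugate i j * pd j L x
          + pd i (fun y => (hess f y).adjugate i j) x * pd j L x
          + (hess f x).adjugate i j * pd i (pd j L) x) := by
    intro i j
    have hLd := aux_diff hΩ hLs hx
    have hLj := aux_diff hΩ (aux_smooth hΩ hLs j) hx
    have hA := aux_diff hΩ (hadj i j) hx
    have hE : DifferentiableAt ℝ (fun y => Real.exp ((-(3/4)) * L y)) x :=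
      (hLd.const_mul _).exp
    have e : ∀ y ∈ Ω, Real.sqrt (hess f y).det * (hess f y)⁻¹ i j * pd j (rho f) y
        = Real.exp ((-(3/4)) * L y) * ((hess f y).adjugate i j * (pd j L y * (-(1/4)))) := by
      intro y hy
      rw [hsqrt y hy, hinv y hy, hdrho y hy]
      have : Real.exp ((-(3/4)) * L y) = Real.exp ((1/2) * L y) * Real.exp ((-1) * L y)
          * Real.exp ((-(1/4)) * L y) := by
        rw [← Real.exp_add, ← Real.exp_add]; congr 1; ring
      rw [this]; ring
    have hc : pd i (fun _ : Fin 2 → ℝ => (-(1/4) : ℝ)) x = 0 := by simp [pd]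
    have hP : DifferentiableAt ℝ (fun y => pd j L y * (-(1/4))) x :=
      hLj.mul (differentiableAt_const _)
    have hQ : DifferentiableAt ℝ
        (fun y => (hess f y).adjugate i j * (pd j L y * (-(1/4)))) x := hA.mul hP
    rw [aux_congr hΩ e hx, aux_mul hE hQ, aux_exp hLd, aux_mul hA hP,
      aux_mul hLj (differentiableAt_const _), hc]
    ring
  have hdiv : ∀ j, pd 0 (fun y => (hess f y).adjugate 0 j) x
      + pd 1 (fun y => (hess f y).adjugate 1 j) x = 0 := by
    have hc01 : ∀ k, pd k (pd 0 (pd 1 f)) x = pd k (pd 1 (pd 0 f)) x := fun k =>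
      aux_congr hΩ (fun y hy => aux_comm hΩ hsmooth hy 0 1) hx k
    have h3 : ∀ j, pd 0 (pd 1 (pd j f)) x = pd 1 (pd 0 (pd j f)) x := fun j =>
      aux_comm hΩ (aux_smooth hΩ hsmooth j) hx 0 1
    intro j
    fin_cases j
    · have e1 : (fun y => (hess f y).adjugate 0 0) = pd 1 (pd 1 f) := by
        funext y; simp [Matrix.adjugate_fin_two, hess]
      have e2 : (fun y => (hess f y).adjugate 1 0) = fun y => - pd 1 (pd 0 f) y := by
        funext y; simp [Matrix.adjugate_fin_two, hess]
      show pd 0 (fun y => (hess f y).adjugate 0 0) x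
        + pd 1 (fun y => (hess f y).adjugate 1 0) x = 0
      rw [e1, e2, aux_neg, h3, hc01]; ring
    · have e1 : (fun y => (hess f y).adjugate 0 1) = fun y => - pd 0 (pd 1 f) y := by
        funext y; simp [Matrix.adjugate_fin_two, hess]
      have e2 : (fun y => (hess f y).adjugate 1 1) = pd 0 (pd 0 f) := by
        funext y; simp [Matrix.adjugate_fin_two, hess]
      show pd 0 (fun y => (hess f y).adjugate 0 1) x
        + pd 1 (fun y => (hess f y).adjugate 1 1) x = 0
      rw [e1, e2, aux_neg, hc01, h3]; ring
  have hd0 := eq_neg_of_add_eq_zero_left (hdiv 0)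
  have hd1 := eq_neg_of_add_eq_zero_left (hdiv 1)
  simp only [calabiLap, gradSq, hterm, hinv x hx, hdrho x hx, hsqrt x hx, hrho x hx,
    Fin.sum_univ_two, hd0, hd1]
  have x1 : (Real.exp (1/2 * L x))⁻¹ = Real.exp ((-(1/4)) * L x) ^ 2 := by
    rw [← Real.exp_neg, ← Real.exp_nat_mul]; congr 1; push_cast; ring
  have x2 : Real.exp ((-(3/4)) * L x) = Real.exp ((-(1/4)) * L x) ^ 3 := by
    rw [← Real.exp_nat_mul]; congr 1; push_cast; ring
  have x3 : Real.exp ((-1) * L x) = Real.exp ((-(1/4)) * L x) ^ 4 := by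
    rw [← Real.exp_nat_mul]; congr 1; push_cast; ring
  rw [x1, x2, x3]
  have hE := Real.exp_pos ((-(1/4)) * L x)
  generalize Real.exp ((-(1/4)) * L x) = E at hE ⊢
  have hE' := hE.ne'
  rw [sub_eq_iff_eq_add, ← sub_eq_iff_eq_add', eq_div_iff hE']
  ring

/-- for a smooth strictly convex `f` on a domain `Ω ⊆ ℝ²`, `ρ` satisfies
`Δρ = 3‖grad ρ‖²/ρ` iff `∑ f^{ij} ∂²/∂x_i∂x_j (ln det(f_kl)) = 0` on `Ω`. -/
theorem statement4 (Ω : Set (Fin 2 → ℝ)) (hΩ : IsOpen Ω)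
    (f : (Fin 2 → ℝ) → ℝ) (hsmooth : ContDiffOn ℝ (⊤ : ℕ∞) f Ω)
    (hconv : ∀ x ∈ Ω, (hess f x).PosDef) :
    (∀ x ∈ Ω, calabiLap f (rho f) x = 3 * gradSq f (rho f) x / rho f x) ↔
    (∀ x ∈ Ω, ∑ i, ∑ j, (hess f x)⁻¹ i j *
        pd i (pd j fun y => Real.log (hess f y).det) x = 0) := by
  refine forall₂_congr fun x hx => ?_
  have h := aux_main Ω hΩ f hsmooth hconv x hx
  have hr : 0 < rho f x := Real.rpow_pos_of_pos (hconv x hx).det_pos _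
  constructor
  · intro h1
    rw [h1, sub_self] at h
    rcases mul_eq_zero.mp h.symm with h2 | h2
    · nlinarith
    · exact h2
  · intro h1
    rw [h1, mul_zero] at h
    linarith
end
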